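/- arXiv:1606.04338 — 2 statements merged into one kernel-verified Lean document; each statement's English description precedes it below -/
import Mathlib

section
/- Let F be a nonzero Laurent polynomial in k variables with integer coefficients, and suppose 0 ∈ ℳ(F). Then 0 is an isolated point of ℳ(F): there is ε > 0 such that ℳ(F) ∩ (0, ε) = ∅. -/
open MeasureTheory

noncomputable section

/-- A Laurent polynomial in `k` variables, given by its finitely supported
coefficient function on exponent vectors in `ℤ^k`. -/
abbrev LPoly (k : ℕ) := (Fin k → ℤ) →₀ ℂ

/-- Evaluation of a Laurent polynomial at a point of `ℂ^k`. -/
def evalT {k : ℕ} (F : LPoly k) (z : Fin k → ℂ) : ℂ :=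
  ∑ e ∈ F.support, F e * ∏ i, z i ^ (e i)

/-- The point of the `k`-torus with angles `t`. -/
def torusPt {k : ℕ} (t : Fin k → ℝ) : Fin k → ℂ :=
  fun i => Complex.exp (2 * Real.pi * Complex.I * (t i))

/-- The logarithmic Mahler measure of a Laurent polynomial in `k` variables. -/
def mm {k : ℕ} (F : LPoly k) : ℝ :=
  ∫ t in Set.Icc (0 : Fin k → ℝ) 1, Real.log ‖evalT F (torusPt t)‖

/-- The exponent substitution attached to an integer matrix `A ∈ ℤ^{ℓ×k}`. -/
def substExp {l k : ℕ} (A : Matrix (Fin l) (Fin k) ℤ) (e : Fin k → ℤ) : Fin l → ℤ :=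
  fun i => ∑ j, A i j * e j

/-- `substM A F` is the Laurent polynomial `F_A(z) = F(z^A)` in `ℓ` variables. -/
def substM {l k : ℕ} (A : Matrix (Fin l) (Fin k) ℤ) (F : LPoly k) : LPoly l :=
  Finsupp.mapDomain (substExp A) F

/-- A one-row integer matrix from a vector `r ∈ ℤ^k`. -/
def rowMat {k : ℕ} (r : Fin k → ℤ) : Matrix (Fin 1) (Fin k) ℤ :=
  Matrix.of fun _ j => r j

/-- The set `ℳ(F)` of Mahler measures of all the nonzero `F_A`. -/
def Mset {k : ℕ} (F : LPoly k) : Set ℝ :=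
  { x | ∃ (l : ℕ) (A : Matrix (Fin l) (Fin k) ℤ), substM A F ≠ 0 ∧ mm (substM A F) = x }

/-- The set `ℳ₁(F)` of Mahler measures of the nonzero one-variable substitutions `F_r`. -/
def M1set {k : ℕ} (F : LPoly k) : Set ℝ :=
  { x | ∃ r : Fin k → ℤ, substM (rowMat r) F ≠ 0 ∧ mm (substM (rowMat r) F) = x }

namespace ZIso
open Polynomial

abbrev toC (f : ℤ[X]) : ℂ[X] := f.map (Int.castRingHom ℂ)

/-- Frobenius congruence for integer polynomials. -/
lemma expand_congr (p : ℕ) [Fact p.Prime] (f : ℤ[X]) :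
    ∃ u : ℤ[X], expand ℤ p f = C (p : ℤ) * u + f ^ p := by
  have h : (expand ℤ p f - f ^ p).map (Int.castRingHom (ZMod p)) = 0 := by
    rw [Polynomial.map_sub, Polynomial.map_pow, map_expand, ZMod.expand_card, sub_self]
  have h2 : C (p : ℤ) ∣ expand ℤ p f - f ^ p := by
    rw [C_dvd_iff_dvd_coeff]
    intro i
    have := congrArg (fun q => q.coeff i) h
    simp only [coeff_map, coeff_zero] at this
    exact (ZMod.intCast_zmod_eq_zero_iff_dvd _ _).1 (by simpa using this)
  obtain ⟨u, hu⟩ := h2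
  exact ⟨u, by rw [← hu]; ring⟩

lemma irred_no_common_root (g h : ℤ[X]) (hg : Irreducible g) (hd : g.natDegree ≠ 0)
    (hgh : ¬ g ∣ h) (x : ℂ) (hx : (toC g).eval x = 0) : (toC h).eval x ≠ 0 := by
  intro hx2
  have hp : g.IsPrimitive := hg.isPrimitive hd
  have hi : Irreducible (g.map (Int.castRingHom ℚ)) :=
    (IsPrimitive.Int.irreducible_iff_irreducible_map_cast hp).1 hg
  have hnd : ¬ g.map (Int.castRingHom ℚ) ∣ h.map (Int.castRingHom ℚ) := by
    intro hh
    exact hgh ((IsPrimitive.Int.dvd_iff_map_cast_dvd_map_cast _ _ hp).2 hh)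
  have hcop : IsCoprime (g.map (Int.castRingHom ℚ)) (h.map (Int.castRingHom ℚ)) :=
    (hi.coprime_iff_not_dvd).2 hnd
  obtain ⟨s, t, hst⟩ := hcop
  have := congrArg (fun q => (q.map (algebraMap ℚ ℂ)).eval x) hst
  simp only [Polynomial.map_add, Polynomial.map_mul, Polynomial.map_map, eval_add, eval_mul,
    Polynomial.map_one, eval_one] at this
  have e : (algebraMap ℚ ℂ).comp (Int.castRingHom ℚ) = Int.castRingHom ℂ := RingHom.ext_int _ _
  rw [e, hx, hx2] at this
  simp at this

lemma res_step (g f : ℤ[X]) (p : ℕ) (hp : p.Prime) (hg : Irreducible g) (hd : g.natDegree ≠ 0)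
    (h1 : g ∣ f) (h2 : ¬ g ∣ expand ℤ p f) (L : ℝ) (hL : 0 ≤ L)
    (hb : ∀ x : ℂ, ‖(toC (expand ℤ p f)).eval x‖ ≤ L * max 1 ‖x‖ ^ (f.natDegree * p)) :
    (p : ℝ) ^ g.natDegree ≤ L ^ g.natDegree * (toC g).mahlerMeasure ^ (f.natDegree * p) := by
  have : Fact p.Prime := ⟨hp⟩
  obtain ⟨u, hu⟩ := expand_congr p f
  obtain ⟨b, hb'⟩ := h1
  have hf0 : f ≠ 0 := by
    rintro rfl; simp at h2
  set N := f.natDegree * p with hN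
  have hpp : f ^ p = g * (b ^ p * g ^ (p - 1)) := by
    conv_lhs => rw [hb', mul_pow]
    obtain ⟨q, rfl⟩ : ∃ q, p = q + 1 := ⟨p - 1, by have := hp.pos; omega⟩
    simp only [Nat.add_sub_cancel]; ring
  have hres : resultant g (expand ℤ p f) g.natDegree N
      = (p : ℤ) ^ g.natDegree * resultant g u g.natDegree N := by
    rw [hu, hpp, resultant_add_mul_right, resultant_C_mul_right]
    · have h3 : (f ^ p).natDegree = N := by rw [natDegree_pow, hN, mul_comm]
      have h4 : f ^ p ≠ 0 := pow_ne_zero _ hf0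
      rw [hpp] at h3 h4
      rw [natDegree_mul (left_ne_zero_of_mul h4) (right_ne_zero_of_mul h4)] at h3
      omega
    · exact le_rfl
  have hinj : Function.Injective (Int.castRingHom ℂ) := (Int.castRingHom ℂ).injective_int
  have hresC : ((resultant g (expand ℤ p f) g.natDegree N : ℤ) : ℂ)
      = (toC g).leadingCoeff ^ N * ((toC g).roots.map (toC (expand ℤ p f)).eval).prod := by
    have := resultant_eq_prod_eval (toC g) (toC (expand ℤ p f)) N
      (natDegree_map_le.trans (by rw [natDegree_expand])) (IsAlgClosed.splits _)
    rw [natDegree_map_eq_of_injective hinj, resultant_map_map] at this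
    simpa using this
  have hg0 : g ≠ 0 := hg.ne_zero
  have hgC : toC g ≠ 0 := by rwa [Ne, Polynomial.map_eq_zero_iff hinj]
  have hne : resultant g (expand ℤ p f) g.natDegree N ≠ 0 := by
    intro h0
    rw [h0] at hresC
    have := hresC.symm
    rw [Int.cast_zero, mul_eq_zero] at this
    rcases this with h | h
    · exact hgC (leadingCoeff_eq_zero.1 (by by_contra h9; exact pow_ne_zero N h9 h))
    · rw [Multiset.prod_eq_zero_iff, Multiset.mem_map] at h
      obtain ⟨x, hx, hx2⟩ := h
      exact irred_no_common_root g _ hg hd h2 x ((mem_roots hgC).1 hx) hx2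
  have hcard : (toC g).roots.card = g.natDegree := by
    rw [← natDegree_map_eq_of_injective hinj g]
    exact (splits_iff_card_roots.1 (IsAlgClosed.splits (toC g)))
  have lower : (p : ℝ) ^ g.natDegree ≤ ‖((resultant g (expand ℤ p f) g.natDegree N : ℤ) : ℂ)‖ := by
    rw [hres] at hne ⊢
    have hr : resultant g u g.natDegree N ≠ 0 := right_ne_zero_of_mul hne
    rw [Complex.norm_intCast]
    push_cast
    rw [abs_mul, abs_pow, Nat.abs_cast]
    have : (1 : ℝ) ≤ |((resultant g u g.natDegree N : ℤ) : ℝ)| := by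
      exact_mod_cast Int.one_le_abs hr
    exact le_mul_of_one_le_right (by positivity) this
  refine lower.trans ?_
  rw [hresC, mahlerMeasure_eq_leadingCoeff_mul_prod_roots, norm_mul, norm_pow, mul_pow]
  have key : ‖((toC g).roots.map (toC (expand ℤ p f)).eval).prod‖
      ≤ L ^ g.natDegree * ((toC g).roots.map (fun a ↦ max 1 ‖a‖)).prod ^ N := by
    rw [← hcard]
    generalize (toC g).roots = s
    induction s using Multiset.induction with
    | empty => simp
    | cons a s ih =>
      simp only [Multiset.map_cons, Multiset.prod_cons, Multiset.card_cons, norm_mul, mul_pow, pow_succ]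
      calc _ ≤ (L * max 1 ‖a‖ ^ N) * (L ^ s.card * ((s.map (fun a ↦ max 1 ‖a‖)).prod) ^ N) :=
            mul_le_mul (hb a) ih (norm_nonneg _) (by positivity)
        _ = _ := by ring
  calc _ ≤ ‖(toC g).leadingCoeff‖ ^ N * (L ^ g.natDegree * ((toC g).roots.map (fun a ↦ max 1 ‖a‖)).prod ^ N) := by gcongr
    _ = _ := by ring

/-- Vandermonde: if all the moments vanish then the sum over each level set vanishes. -/
lemma vdm {ι : Type} [Fintype ι] [DecidableEq ι] (b y : ι → ℂ)
    (h : ∀ j < Fintype.card ι, ∑ i, b i * y i ^ j = 0) (i₀ : ι) :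
    ∑ i, (if y i = y i₀ then b i else 0) = 0 := by
  classical
  set Y := (Finset.univ.image y).erase (y i₀) with hY
  set P : ℂ[X] := ∏ z ∈ Y, (X - C z) with hP
  have hdeg : P.natDegree < Fintype.card ι := by
    rw [hP, natDegree_prod_of_monic _ _ (fun z _ => monic_X_sub_C z)]
    simp only [natDegree_X_sub_C, Finset.sum_const, smul_eq_mul, mul_one]
    have h1 : Y.card < (Finset.univ.image y).card :=
      Finset.card_erase_lt_of_mem (Finset.mem_image_of_mem y (Finset.mem_univ i₀))
    exact lt_of_lt_of_le h1 Finset.card_image_le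
  have h2 : ∑ i, b i * P.eval (y i) = 0 := by
    simp_rw [eval_eq_sum_range, Finset.mul_sum]
    rw [Finset.sum_comm]
    apply Finset.sum_eq_zero
    intro j hj
    have := h j (lt_of_lt_of_le (Finset.mem_range.1 hj) hdeg)
    calc _ = P.coeff j * ∑ i, b i * y i ^ j := by
            rw [Finset.mul_sum]; exact Finset.sum_congr rfl (fun i _ => by ring)
      _ = 0 := by rw [this, mul_zero]
  have h3 : ∀ i, b i * P.eval (y i) = P.eval (y i₀) * (if y i = y i₀ then b i else 0) := by
    intro i
    split_ifs with hi
    · rw [hi]; ring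
    · have : P.eval (y i) = 0 := by
        rw [hP, eval_prod]
        apply Finset.prod_eq_zero (i := y i)
        · simp [hY, hi]
        · simp
      rw [this]; ring
  simp_rw [h3, ← Finset.mul_sum] at h2
  refine (mul_eq_zero.1 h2).resolve_left ?_
  rw [hP, eval_prod, ← Ne, Finset.prod_ne_zero_iff]
  intro z hz
  simp only [eval_sub, eval_X, eval_C]
  rw [sub_ne_zero]
  exact (Finset.ne_of_mem_erase hz).symm

/-- The polynomial with given coefficients and exponents. -/
def spoly {ι : Type} [Fintype ι] (a : ι → ℤ) (n : ι → ℕ) : ℤ[X] := ∑ i, C (a i) * X ^ n i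

lemma spoly_eval {ι : Type} [Fintype ι] (a : ι → ℤ) (n : ι → ℕ) (x : ℂ) :
    (toC (spoly a n)).eval x = ∑ i, (a i : ℂ) * x ^ n i := by
  simp [spoly, Polynomial.map_sum, eval_finsetSum]

lemma mult_bound {ι : Type} [Fintype ι] [DecidableEq ι] (a : ι → ℂ) (ha : ∀ i, a i ≠ 0) (n : ι → ℕ)
    (hn : Function.Injective n) (i₀ : ι) (α : ℂ) (hα : α ≠ 0) :
    rootMultiplicity α (∑ i, C (a i) * X ^ n i) < Fintype.card ι := by
  by_contra! hK
  have hdiv : (X - C α) ^ Fintype.card ι ∣ (∑ i, C (a i) * X ^ n i) :=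
    (pow_dvd_pow _ hK).trans (pow_rootMultiplicity_dvd _ _)
  have step : ∀ j ≤ Fintype.card ι, (X - C α) ^ (Fintype.card ι - j) ∣
      (∑ i, C (a i * (n i : ℂ) ^ j) * X ^ n i) := by
    intro j
    induction j with
    | zero => intro _; simpa using hdiv
    | succ j ih =>
      intro hj
      have h1 := ih (by omega)
      have h2 : (∑ i, C (a i * (n i : ℂ) ^ (j + 1)) * X ^ n i)
          = X * derivative (∑ i, C (a i * (n i : ℂ) ^ j) * X ^ n i) := by
        simp only [derivative_sum, Finset.mul_sum]
        apply Finset.sum_congr rfl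
        intro i _
        simp only [derivative_C_mul, derivative_X_pow]
        rcases Nat.eq_zero_or_pos (n i) with h0 | h0
        · simp [h0]
        · obtain ⟨q, hq⟩ : ∃ q, n i = q + 1 := ⟨n i - 1, by omega⟩
          rw [hq]
          simp only [Nat.add_sub_cancel, pow_succ, map_mul]
          push_cast
          simp
          ring
      rw [h2]
      apply Dvd.dvd.mul_left
      obtain ⟨q, hq⟩ : ∃ q, Fintype.card ι - j = q + 1 := ⟨Fintype.card ι - j - 1, by omega⟩
      rw [hq] at h1
      obtain ⟨w, hw⟩ := h1
      rw [hw]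
      have hq2 : Fintype.card ι - (j + 1) = q := by omega
      rw [hq2]
      simp only [derivative_mul, derivative_X_sub_C_pow]
      apply dvd_add
      · simp only [Nat.add_sub_cancel]
        exact Dvd.dvd.mul_right (Dvd.dvd.mul_left dvd_rfl _) _
      · exact Dvd.dvd.mul_right (pow_dvd_pow _ (by omega)) _
  have h := vdm (fun i => a i * α ^ n i) (fun i => (n i : ℂ)) (by
    intro j hj
    have h1 := step j hj.le
    have h2 : (X - C α) ∣ (∑ i, C (a i * (n i : ℂ) ^ j) * X ^ n i) :=
      (dvd_pow_self _ (by omega)).trans h1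
    rw [dvd_iff_isRoot, IsRoot.def] at h2
    simp only [eval_finsetSum, eval_mul, eval_C, eval_pow, eval_X] at h2
    rw [← h2]
    exact Finset.sum_congr rfl (fun i _ => by ring)) i₀
  have h3 : ∀ i, (if (n i : ℂ) = (n i₀ : ℂ) then a i * α ^ n i else 0) = if i = i₀ then a i * α ^ n i else 0 := by
    intro i
    have : ((n i : ℂ) = (n i₀ : ℂ)) ↔ i = i₀ := by rw [Nat.cast_inj, hn.eq_iff]
    simp [this]
  simp_rw [h3] at h
  simp [ha, hα] at h

end ZIso

namespace ZIso
open Polynomial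

lemma chain_step (Λ : ℕ → Prop) (h1 : Λ 1) (m : ℕ) (hm : 0 < m) (hn : ¬ Λ m) :
    ∃ m' p, p.Prime ∧ m' * p ∣ m ∧ Λ m' ∧ ¬ Λ (m' * p) := by
  induction m using Nat.strong_induction_on with
  | _ m ih =>
    have hm1 : m ≠ 1 := by rintro rfl; exact hn h1
    have hp := Nat.minFac_prime hm1
    obtain ⟨q, hq⟩ := Nat.minFac_dvd m
    by_cases hΛ : Λ q
    · refine ⟨q, m.minFac, hp, ?_, hΛ, ?_⟩
      · rw [mul_comm, ← hq]
      · rw [mul_comm, ← hq]; exact hn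
    · have hq0 : 0 < q := by
        rcases Nat.eq_zero_or_pos q with h | h
        · rw [h] at hq; omega
        · exact h
      have hlt : q < m := by
        have := hp.two_le
        calc q < 2 * q := by omega
          _ ≤ m.minFac * q := Nat.mul_le_mul_right _ this
          _ = m := hq.symm
      obtain ⟨m', p, h2, h3, h4, h5⟩ := ih q hlt hq0 hΛ
      exact ⟨m', p, h2, h3.trans ⟨m.minFac, by rw [mul_comm]; exact hq⟩, h4, h5⟩

lemma toC_expand_eval (q : ℕ) (f : ℤ[X]) (x : ℂ) :
    (toC (expand ℤ q f)).eval x = (toC f).eval (x ^ q) := by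
  unfold toC
  rw [map_expand, expand_eval]

section U
variable {ι : Type} [Fintype ι] [DecidableEq ι]

lemma spoly_coeff (a : ι → ℤ) (n : ι → ℕ) (hn : Function.Injective n) (i : ι) :
    (spoly a n).coeff (n i) = a i := by
  simp only [spoly, finsetSum_coeff, coeff_C_mul, coeff_X_pow]
  rw [Finset.sum_eq_single i]
  · simp
  · intro j _ hj
    have : n i ≠ n j := fun h => hj (hn h).symm
    simp [this]
  · simp

lemma le_natDegree_spoly (a : ι → ℤ) (ha : ∀ i, a i ≠ 0) (n : ι → ℕ) (hn : Function.Injective n)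
    (i : ι) : n i ≤ (spoly a n).natDegree :=
  le_natDegree_of_ne_zero (by rw [spoly_coeff a n hn]; exact ha i)

def len (a : ι → ℤ) : ℕ := ∑ i, (a i).natAbs

/-- Property B of a complex number. -/
def PB (a : ι → ℤ) (n : ι → ℕ) (x : ℂ) : Prop :=
  ∀ j < Fintype.card ι, (toC (spoly a n)).eval (x ^ (1 + j * (len a).factorial)) = 0

lemma spoly_bound (a : ι → ℤ) (ha : ∀ i, a i ≠ 0) (n : ι → ℕ) (hn : Function.Injective n)
    (q : ℕ) (x : ℂ) : ‖(toC (spoly a n)).eval (x ^ q)‖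
      ≤ (len a : ℝ) * max 1 ‖x‖ ^ ((spoly a n).natDegree * q) := by
  rw [spoly_eval]
  refine (norm_sum_le _ _).trans ?_
  have : (len a : ℝ) = ∑ i, |(a i : ℝ)| := by
    simp [len, Nat.cast_natAbs]
  rw [this, Finset.sum_mul]
  apply Finset.sum_le_sum
  intro i _
  rw [norm_mul, Complex.norm_intCast, ← pow_mul, norm_pow]
  gcongr
  calc ‖x‖ ^ (q * n i) ≤ (max 1 ‖x‖) ^ (q * n i) := by gcongr; exact le_max_right _ _
    _ ≤ _ := by
      apply pow_le_pow_right₀ (le_max_left _ _)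
      rw [mul_comm]
      exact Nat.mul_le_mul_right _ (le_natDegree_spoly a ha n hn i)

lemma factor_dich (a : ι → ℤ) (ha : ∀ i, a i ≠ 0) (hL : 0 < len a) (n : ι → ℕ)
    (hn : Function.Injective n)
    (g : ℤ[X]) (hg : Irreducible g) (hd : g.natDegree ≠ 0) (hgf : g ∣ spoly a n) :
    (g.natDegree : ℝ) * Real.log ((len a + 1) / len a) ≤
      ((spoly a n).natDegree * (1 + Fintype.card ι * (len a).factorial) : ℕ)
        * (toC g).logMahlerMeasure
    ∨ ∀ x, (toC g).eval x = 0 → PB a n x := by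
  by_cases hB : ∀ j < Fintype.card ι, g ∣ expand ℤ (1 + j * (len a).factorial) (spoly a n)
  · right
    intro x hx j hj
    obtain ⟨w, hw⟩ := hB j hj
    rw [← toC_expand_eval, hw]
    simp [toC, Polynomial.map_mul] at hx ⊢
    left; exact hx
  · left
    push Not at hB
    obtain ⟨j, hj, hnd⟩ := hB
    obtain ⟨m', p, hp, hdiv, h3, h4⟩ := chain_step (fun q => g ∣ expand ℤ q (spoly a n))
      (by simpa using hgf) (1 + j * (len a).factorial) (by omega) hnd
    have hpL : len a + 1 ≤ p := by
      by_contra! hlt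
      have h5 : p ∣ (len a).factorial := hp.dvd_factorial.2 (by omega)
      have h6 : p ∣ 1 + j * (len a).factorial := (Dvd.intro_left _ rfl).trans hdiv
      have h7 : p ∣ 1 := (Nat.dvd_add_left (h5.mul_left j)).1 h6
      exact hp.one_lt.ne' (Nat.dvd_one.1 h7)
    have hm'0 : 0 < m' := by
      rcases Nat.eq_zero_or_pos m' with h | h
      · rw [h, zero_mul, zero_dvd_iff] at hdiv; omega
      · exact h
    have hexp : expand ℤ p (expand ℤ m' (spoly a n)) = expand ℤ (m' * p) (spoly a n) := by
      rw [expand_expand, mul_comm]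
    have hle : m' * p ≤ 1 + Fintype.card ι * (len a).factorial := by
      refine (Nat.le_of_dvd (by omega) hdiv).trans ?_
      have := Nat.mul_le_mul_right (len a).factorial hj.le
      omega
    have key := res_step g (expand ℤ m' (spoly a n)) p hp hg hd h3 (by rw [hexp]; exact h4)
      (len a) (by positivity) (by
        intro x
        rw [hexp, toC_expand_eval, natDegree_expand, mul_assoc]
        exact spoly_bound a ha n hn _ x)
    rw [natDegree_expand] at key
    have hM : 1 ≤ (toC g).mahlerMeasure := one_le_mahlerMeasure_of_ne_zero hg.ne_zero
    have hlog := Real.log_le_log (by have := hp.pos; positivity) key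
    have hLpos : (0 : ℝ) < len a := by exact_mod_cast hL
    rw [Real.log_mul (by positivity) (by positivity), Real.log_pow, Real.log_pow, Real.log_pow,
      ← logMahlerMeasure_eq_log_MahlerMeasure] at hlog
    have h0 : 0 ≤ (toC g).logMahlerMeasure := by
      rw [logMahlerMeasure_eq_log_MahlerMeasure]; exact Real.log_nonneg hM
    rw [Real.log_div (by positivity) (by positivity)]
    have h8 : Real.log (len a + 1) ≤ Real.log p := Real.log_le_log (by positivity) (by exact_mod_cast hpL)
    have h9 : (((spoly a n).natDegree * m' * p : ℕ) : ℝ) * (toC g).logMahlerMeasure ≤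
      ((spoly a n).natDegree * (1 + Fintype.card ι * (len a).factorial) : ℕ)
        * (toC g).logMahlerMeasure := by
      apply mul_le_mul_of_nonneg_right _ h0
      rw [mul_assoc]
      exact_mod_cast Nat.mul_le_mul_left _ hle
    have h10 : (g.natDegree : ℝ) * Real.log (len a + 1) ≤ g.natDegree * Real.log p := by gcongr
    linarith

open Classical in
lemma all_dich (a : ι → ℤ) (ha : ∀ i, a i ≠ 0) (hL : 0 < len a) (n : ι → ℕ)
    (hn : Function.Injective n) (hf0 : spoly a n ≠ 0) :
    (((spoly a n).natDegree : ℝ) - ((toC (spoly a n)).roots.filter (PB a n)).card)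
      * Real.log ((len a + 1) / len a) ≤
      ((spoly a n).natDegree * (1 + Fintype.card ι * (len a).factorial) : ℕ)
        * (toC (spoly a n)).logMahlerMeasure := by
  have hinj : Function.Injective (Int.castRingHom ℂ) := (Int.castRingHom ℂ).injective_int
  have nonneg : ∀ g : ℤ[X], g ≠ 0 → 0 ≤ (toC g).logMahlerMeasure := by
    intro g hg
    rw [logMahlerMeasure_eq_log_MahlerMeasure]
    exact Real.log_nonneg (one_le_mahlerMeasure_of_ne_zero hg)
  have hcard : ∀ g : ℤ[X], (toC g).roots.card = g.natDegree := by
    intro g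
    rw [← natDegree_map_eq_of_injective hinj g]
    exact (splits_iff_card_roots.1 (IsAlgClosed.splits (toC g)))
  have hLpos : (0 : ℝ) < len a := by exact_mod_cast hL
  have hlogpos : 0 ≤ Real.log ((len a + 1) / len a) := by
    apply Real.log_nonneg; rw [le_div_iff₀ hLpos]; linarith
  suffices H : ∀ g : ℤ[X], g ≠ 0 → g ∣ spoly a n →
      ((g.natDegree : ℝ) - ((toC g).roots.filter (PB a n)).card)
      * Real.log ((len a + 1) / len a) ≤
      ((spoly a n).natDegree * (1 + Fintype.card ι * (len a).factorial) : ℕ)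
        * (toC g).logMahlerMeasure from H _ hf0 dvd_rfl
  intro g
  induction g using WfDvdMonoid.induction_on_irreducible with
  | zero => intro h; exact absurd rfl h
  | unit u hu =>
    intro h0 _
    have : u.natDegree = 0 := natDegree_eq_zero_of_isUnit hu
    rw [this]
    calc _ ≤ (0 : ℝ) := by
            apply mul_nonpos_of_nonpos_of_nonneg _ hlogpos
            simp
      _ ≤ _ := mul_nonneg (by positivity) (nonneg u h0)
  | mul b i hb0 hi ih =>
    intro h0 hdiv
    have hi0 := hi.ne_zero
    have hb := ih hb0 ((Dvd.intro_left i rfl).trans hdiv)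
    have hmap : toC (i * b) = toC i * toC b := Polynomial.map_mul _
    have hne : toC i * toC b ≠ 0 := by rw [← hmap]; rwa [Ne, Polynomial.map_eq_zero_iff hinj]
    rw [hmap, logMahlerMeasure_mul_eq_add_logMahlerMeasure hne, roots_mul hne, Multiset.filter_add,
      Multiset.card_add, natDegree_mul hi0 hb0]
    have hI : ((i.natDegree : ℝ) - ((toC i).roots.filter (PB a n)).card)
      * Real.log ((len a + 1) / len a) ≤
      ((spoly a n).natDegree * (1 + Fintype.card ι * (len a).factorial) : ℕ)
        * (toC i).logMahlerMeasure := by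
      by_cases hd : i.natDegree = 0
      · rw [hd]
        calc _ ≤ (0 : ℝ) := by
                apply mul_nonpos_of_nonpos_of_nonneg _ hlogpos
                simp
          _ ≤ _ := mul_nonneg (by positivity) (nonneg i hi0)
      rcases factor_dich a ha hL n hn i hi hd ((Dvd.intro b rfl).trans hdiv) with h | h
      · refine le_trans ?_ h
        apply mul_le_mul_of_nonneg_right _ hlogpos
        simp
      · have : (toC i).roots.filter (PB a n) = (toC i).roots := by
          rw [Multiset.filter_eq_self]
          intro x hx
          exact h x ((mem_roots (left_ne_zero_of_mul hne)).1 hx)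
        rw [this, hcard, sub_self, zero_mul]
        exact mul_nonneg (by positivity) (nonneg i hi0)
    push_cast at *
    linarith
end U
end ZIso

namespace ZIso
open Polynomial

lemma PB_blocks {ι : Type} [Fintype ι] [DecidableEq ι] (a : ι → ℤ) (n : ι → ℕ) (x : ℂ)
    (hx : PB a n x) (i : ι) :
    ∑ j, (if x ^ ((len a).factorial * n i) = x ^ ((len a).factorial * n j)
      then (a j : ℂ) * x ^ n j else 0) = 0 := by
  have := vdm (fun j => (a j : ℂ) * x ^ n j) (fun j => x ^ ((len a).factorial * n j)) (by
    intro t ht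
    have := hx t ht
    rw [spoly_eval] at this
    rw [← this]
    apply Finset.sum_congr rfl
    intro j _
    rw [mul_assoc, ← pow_mul, ← pow_mul, ← pow_add]
    congr 2
    ring) i
  refine (Finset.sum_congr rfl ?_).trans this
  intro j _
  exact if_congr eq_comm rfl rfl

theorem univ_lemma {ι : Type} [Fintype ι] [DecidableEq ι] (a : ι → ℤ) (ha : ∀ i, a i ≠ 0)
    (hcard : 2 ≤ Fintype.card ι) :
    ∃ c > (0 : ℝ), ∃ B : ℕ, ∃ Q : ℕ, 0 < Q ∧ ∀ n : ι → ℕ, Function.Injective n → (∃ i, n i = 0) →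
      c ≤ (toC (spoly a n)).logMahlerMeasure ∨
      ∃ (r : Finset (ι × ι)) (D : ℤ) (m g : ι × ι → ℤ) (β : ℂ), 0 < D ∧ β ^ Q = 1 ∧
        (∀ i j, (i, j) ∈ r → ((n j : ℤ) - n i) = D * m (i, j)) ∧
        (∀ p, |m p| ≤ B) ∧
        (∑ p ∈ r, m p * g p = 1) ∧
        (∀ i, (i, i) ∈ r) ∧ (∀ i j, (i, j) ∈ r → (j, i) ∈ r) ∧
        (∀ i j k, (i, j) ∈ r → (j, k) ∈ r → (i, k) ∈ r) ∧
        ∀ i, ∑ j, (if (i, j) ∈ r then (a j : ℂ) * β ^ m (i, j) else 0) = 0 := by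
  classical
  obtain ⟨i1, i2, hi12⟩ := Fintype.one_lt_card_iff.1 (show 1 < Fintype.card ι by omega)
  have hL : 0 < len a := by
    have : (a i1).natAbs ≤ len a :=
      Finset.single_le_sum (f := fun i => (a i).natAbs) (fun _ _ => Nat.zero_le _) (Finset.mem_univ i1)
    have := Int.natAbs_pos.2 (ha i1)
    omega
  have hLpos : (0 : ℝ) < len a := by exact_mod_cast hL
  set K := Fintype.card ι with hK
  set Q := (len a).factorial with hQ
  have hQ0 : 0 < Q := Nat.factorial_pos _
  set Lg := Real.log ((len a + 1) / len a) with hLg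
  have hLg0 : 0 < Lg := by
    apply Real.log_pos; rw [lt_div_iff₀ hLpos]; linarith
  set P := Fintype.card (Finset (ι × ι)) with hP
  refine ⟨Lg / (2 * (1 + K * Q)), by positivity, 2 * K * P * Q, Q, hQ0, ?_⟩
  intro n hn ⟨i0, hi0⟩
  have hinj : Function.Injective (Int.castRingHom ℂ) := (Int.castRingHom ℂ).injective_int
  set f := spoly a n with hf
  set N := f.natDegree with hN
  have hnN : ∀ i, n i ≤ N := le_natDegree_spoly a ha n hn
  have hN1 : 1 ≤ N := by
    have h1 := hnN i1
    have h2 := hnN i2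
    have : n i1 ≠ n i2 := fun h => hi12 (hn h)
    omega
  have hf0 : f ≠ 0 := by rintro h; rw [hN, h] at hN1; simp at hN1
  have hfC : toC f ≠ 0 := by rwa [Ne, Polynomial.map_eq_zero_iff hinj]
  have hdich := all_dich a ha hL n hn hf0
  set S := (toC f).roots.filter (PB a n) with hS
  by_cases hT : 2 * S.card ≤ N
  · left
    have hT' : (2 : ℝ) * S.card ≤ N := by exact_mod_cast hT
    have hN' : (1 : ℝ) ≤ N := by exact_mod_cast hN1
    rw [div_le_iff₀ (by positivity)]
    have h1 : (N : ℝ) / 2 * Lg ≤ (N - S.card) * Lg := by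
      apply mul_le_mul_of_nonneg_right _ hLg0.le; linarith
    have h2 := h1.trans hdich
    push_cast at h2
    have h3 : (N : ℝ) * Lg ≤ N * ((toC f).logMahlerMeasure * (2 * (1 + K * Q))) := by linarith
    exact le_of_mul_le_mul_left h3 (by linarith)
  right
  push Not at hT
  set Bs := S.toFinset with hBs
  have hBs_mem : ∀ x ∈ Bs, PB a n x ∧ x ≠ 0 := by
    intro x hx
    rw [hBs, Multiset.mem_toFinset, hS, Multiset.mem_filter] at hx
    refine ⟨hx.2, ?_⟩
    rintro rfl
    have h1 : (toC f).eval 0 = 0 := (mem_roots hfC).1 hx.1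
    rw [← coeff_zero_eq_eval_zero, coeff_map, ← hi0, hf, spoly_coeff a n hn] at h1
    simp at h1
    exact ha i0 h1
  have hcount : S.card ≤ Bs.card * K := by
    rw [← Multiset.toFinset_sum_count_eq S, ← smul_eq_mul]
    apply Finset.sum_le_card_nsmul
    intro x hx
    have h1 : S.count x ≤ (toC f).roots.count x := Multiset.count_le_of_le _ (Multiset.filter_le _ _)
    rw [count_roots] at h1
    have h2 : toC f = ∑ i, C ((a i : ℂ)) * X ^ n i := by
      simp [hf, spoly, toC, Polynomial.map_sum]
    rw [h2] at h1
    have h3 := mult_bound (fun i => (a i : ℂ)) (fun i => by exact_mod_cast ha i) n hn i0 x (hBs_mem x hx).2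
    exact h1.trans h3.le
  let pat : ℂ → Finset (ι × ι) := fun x =>
    Finset.univ.filter (fun p => x ^ (Q * n p.1) = x ^ (Q * n p.2))
  obtain ⟨r, -, hr⟩ := Finset.exists_max_image (Finset.univ : Finset (Finset (ι × ι)))
    (fun r => (Bs.filter (fun x => pat x = r)).card) ⟨∅, Finset.mem_univ _⟩
  set Fb := Bs.filter (fun x => pat x = r) with hFb
  have hBF : Bs.card ≤ P * Fb.card := by
    rw [Finset.card_eq_sum_card_fiberwise (f := pat) (t := Finset.univ) (fun _ _ => Finset.mem_univ _),
      hP, ← Finset.card_univ, ← smul_eq_mul]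
    exact Finset.sum_le_card_nsmul _ _ _ (fun s hs => hr s hs)
  have hFpos : 0 < Fb.card := by
    rcases Nat.eq_zero_or_pos Fb.card with h | h
    · rw [h] at hBF
      have : Bs.card = 0 := by omega
      rw [this] at hcount
      omega
    · exact h
  obtain ⟨x, hx⟩ := Finset.card_pos.1 hFpos
  have hxB := hBs_mem x (Finset.mem_filter.1 hx).1
  have hpat : ∀ y ∈ Fb, ∀ i j, (i, j) ∈ r ↔ y ^ (Q * n i) = y ^ (Q * n j) := by
    intro y hy i j
    rw [← (Finset.mem_filter.1 hy).2]
    simp [pat]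
  set D := r.gcd (fun p => ((n p.2 : ℤ) - n p.1)) with hD
  obtain ⟨g, hg⟩ := Finset.gcd_eq_sum_mul r (fun p => ((n p.2 : ℤ) - n p.1))
  rw [← hD] at hg
  have hDdvd : ∀ i j, (i, j) ∈ r → D ∣ ((n j : ℤ) - n i) := fun i j hij =>
    Finset.gcd_dvd (f := fun p : ι × ι => ((n p.2 : ℤ) - n p.1)) hij
  have hDnn : 0 ≤ D := Int.nonneg_of_normalize_eq_self (Finset.normalize_gcd)
  have hblock : ∀ i, ∑ j, (if (i, j) ∈ r then (a j : ℂ) * x ^ n j else 0) = 0 := by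
    intro i
    have := PB_blocks a n x hxB.1 i
    refine (Finset.sum_congr rfl ?_).trans this
    intro j _
    simp only [hpat x hx i j, hQ]
  have hrefl : ∀ i, (i, i) ∈ r := fun i => by rw [hpat x hx]
  have hDpos : 0 < D := by
    rcases hDnn.lt_or_eq with h | h
    · exact h
    exfalso
    have h1 : ∀ i j, (i, j) ∈ r ↔ i = j := by
      intro i j
      constructor
      · intro hij
        have h2 := hDdvd i j hij
        rw [← h, zero_dvd_iff] at h2
        exact hn (by omega)
      · rintro rfl; exact hrefl i
    have h2 := hblock i0
    simp only [h1] at h2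
    simp [ha i0, hxB.2] at h2
  have hpow : ∀ y ∈ Fb, y ^ (Q * D.toNat) = 1 := by
    intro y hy
    have hy0 := (hBs_mem y (Finset.mem_filter.1 hy).1).2
    set u : ℂˣ := Units.mk0 y hy0 with hu
    have h1 : ∀ p ∈ r, (orderOf u : ℤ) ∣ Q * ((n p.2 : ℤ) - n p.1) := by
      intro p hp
      rw [orderOf_dvd_iff_zpow_eq_one, mul_sub, zpow_sub]
      have h2 := (hpat y hy p.1 p.2).1 hp
      rw [mul_inv_eq_one]
      ext
      have h3 : ∀ k : ℕ, ((u ^ ((Q : ℤ) * k) : ℂˣ) : ℂ) = y ^ (Q * k) := by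
        intro k
        rw [← Nat.cast_mul, zpow_natCast, Units.val_pow_eq_pow_val]; rfl
      rw [h3, h3, h2]
    have h2 : (orderOf u : ℤ) ∣ Q * D := by
      rw [hg, Finset.mul_sum]
      apply Finset.dvd_sum
      intro p hp
      rw [← mul_assoc]
      exact (h1 p hp).mul_right _
    have h3 : orderOf u ∣ Q * D.toNat := by
      zify
      rwa [Int.toNat_of_nonneg hDnn]
    have h4 := orderOf_dvd_iff_pow_eq_one.1 h3
    have h5 := congrArg (fun w : ℂˣ => (w : ℂ)) h4
    simpa [hu] using h5
  have hQD : 0 < Q * D.toNat := Nat.mul_pos hQ0 (by omega)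
  have hFle : Fb.card ≤ Q * D.toNat := by
    have h1 : Fb ⊆ (nthRoots (Q * D.toNat) (1 : ℂ)).toFinset := by
      intro y hy
      rw [Multiset.mem_toFinset, mem_nthRoots hQD]
      exact hpow y hy
    exact (Finset.card_le_card h1).trans ((Multiset.toFinset_card_le _).trans (card_nthRoots _ _))
  have hNle : N ≤ 2 * K * P * Q * D.toNat := by
    calc N ≤ 2 * S.card := hT.le
      _ ≤ 2 * (Bs.card * K) := by gcongr
      _ ≤ 2 * ((P * Fb.card) * K) := by gcongr
      _ ≤ 2 * ((P * (Q * D.toNat)) * K) := by gcongr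
      _ = _ := by ring
  have hmD : ∀ i j, (i, j) ∈ r → ((n j : ℤ) - n i) = D * (((n j : ℤ) - n i) / D) :=
    fun i j hij => (Int.mul_ediv_cancel' (hDdvd i j hij)).symm
  refine ⟨r, D, fun p => if p ∈ r then ((n p.2 : ℤ) - n p.1) / D else 0, g, x ^ D.toNat, hDpos,
    ?_, ?_, ?_, ?_, hrefl, ?_, ?_, ?_⟩
  · rw [← pow_mul, mul_comm]; exact hpow x hx
  · intro i j hij
    simp only [hij, if_true]
    exact hmD i j hij
  · intro p
    dsimp only
    split_ifs with hp
    · have h1 := hmD p.1 p.2 hp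
      set q := ((n p.2 : ℤ) - n p.1) / D with hq
      have h2 : |(n p.2 : ℤ) - n p.1| ≤ N := by
        have := hnN p.1; have := hnN p.2
        rw [abs_le]; constructor <;> omega
      have h3 : (N : ℤ) ≤ ((2 * K * P * Q : ℕ) : ℤ) * D := by
        have : ((N : ℕ) : ℤ) ≤ ((2 * K * P * Q * D.toNat : ℕ) : ℤ) := by exact_mod_cast hNle
        rw [Nat.cast_mul, Int.toNat_of_nonneg hDnn] at this
        exact this
      rw [h1, abs_mul, abs_of_pos hDpos] at h2
      have h4 : D * |q| ≤ D * ((2 * K * P * Q : ℕ) : ℤ) := by linarith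
      exact le_of_mul_le_mul_left h4 hDpos
    · rw [abs_zero]; exact Int.natCast_nonneg _
  · have h1 : D * ∑ p ∈ r, (if p ∈ r then ((n p.2 : ℤ) - n p.1) / D else 0) * g p = D * 1 := by
      rw [mul_one]
      conv_rhs => rw [hg]
      rw [Finset.mul_sum]
      apply Finset.sum_congr rfl
      intro p hp
      rw [if_pos hp, ← mul_assoc, ← hmD p.1 p.2 hp]
    exact mul_left_cancel₀ hDpos.ne' h1
  · intro i j; rw [hpat x hx, hpat x hx]; exact fun h => h.symm
  · intro i j k; rw [hpat x hx, hpat x hx, hpat x hx]; exact fun h h' => h.trans h'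
  · intro i
    have h1 : ∀ j, (if (i, j) ∈ r then (a j : ℂ) * (x ^ D.toNat) ^
        ((fun p : ι × ι => if p ∈ r then ((n p.2 : ℤ) - n p.1) / D else 0) (i, j)) else 0)
        = (x ^ n i)⁻¹ * (if (i, j) ∈ r then (a j : ℂ) * x ^ n j else 0) := by
      intro j
      split_ifs with hij
      · simp only [hij, if_true]
        rw [← zpow_natCast x D.toNat, ← zpow_mul, Int.toNat_of_nonneg hDnn, ← hmD i j hij,
          zpow_sub₀ hxB.2, zpow_natCast, zpow_natCast]
        field_simp
      · simp
    rw [Finset.sum_congr rfl (fun j _ => h1 j), ← Finset.mul_sum, hblock, mul_zero]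
end ZIso

namespace ZIso
open Polynomial

/-- Pairing of an integer vector and a real vector. -/
def dot {l : ℕ} (u : Fin l → ℤ) (t : Fin l → ℝ) : ℝ := ∑ i, (u i : ℝ) * t i

/-- The character attached to an integer vector. -/
def ech {l : ℕ} (u : Fin l → ℤ) (t : Fin l → ℝ) : ℂ :=
  Complex.exp (2 * Real.pi * Complex.I * (dot u t : ℂ))

lemma dot_add {l : ℕ} (u v : Fin l → ℤ) (t : Fin l → ℝ) : dot (u + v) t = dot u t + dot v t := by
  simp [dot, add_mul, Finset.sum_add_distrib]

lemma dot_neg {l : ℕ} (u : Fin l → ℤ) (t : Fin l → ℝ) : dot (-u) t = - dot u t := by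
  simp [dot, Finset.sum_neg_distrib]

lemma dot_zero {l : ℕ} (t : Fin l → ℝ) : dot (0 : Fin l → ℤ) t = 0 := by
  simp [dot]

lemma dot_add_right {l : ℕ} (u : Fin l → ℤ) (t s : Fin l → ℝ) :
    dot u (t + s) = dot u t + dot u s := by
  simp [dot, mul_add, Finset.sum_add_distrib]

lemma dot_smul_right {l : ℕ} (u : Fin l → ℤ) (x : ℝ) (s : Fin l → ℝ) :
    dot u (x • s) = x * dot u s := by
  simp only [dot, Finset.mul_sum, Pi.smul_apply, smul_eq_mul]
  exact Finset.sum_congr rfl fun i _ => by ring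

lemma ech_add {l : ℕ} (u v : Fin l → ℤ) (t : Fin l → ℝ) : ech (u + v) t = ech u t * ech v t := by
  rw [ech, ech, ech, ← Complex.exp_add, dot_add]; push_cast; ring_nf

lemma ech_zero {l : ℕ} (t : Fin l → ℝ) : ech (0 : Fin l → ℤ) t = 1 := by
  simp [ech, dot_zero]

lemma norm_ech {l : ℕ} (u : Fin l → ℤ) (t : Fin l → ℝ) : ‖ech u t‖ = 1 := by
  rw [ech, show (2 * Real.pi * Complex.I * (dot u t : ℂ)) = ((2 * Real.pi * dot u t : ℝ) : ℂ) * Complex.I by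
    push_cast; ring]
  exact Complex.norm_exp_ofReal_mul_I _

lemma conj_ech {l : ℕ} (u : Fin l → ℤ) (t : Fin l → ℝ) :
    (starRingEnd ℂ) (ech u t) = ech (-u) t := by
  rw [ech, ech, ← Complex.exp_conj, dot_neg]
  congr 1
  simp only [map_mul, Complex.conj_ofReal, Complex.conj_I, map_ofNat]
  push_cast; ring

lemma continuous_dot {l : ℕ} (u : Fin l → ℤ) : Continuous (dot u) := by
  unfold dot; fun_prop

lemma continuous_ech {l : ℕ} (u : Fin l → ℤ) : Continuous (ech u) := by
  unfold ech
  have := continuous_dot u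
  fun_prop

lemma mp_dot {l : ℕ} (u : Fin l → ℤ) (hu : u ≠ 0) :
    MeasurePreserving (fun t : Fin l → ℝ => ((dot u t : ℝ) : UnitAddCircle))
      (volume.restrict (Set.Icc (0 : Fin l → ℝ) 1)) volume := by
  have h1 : MeasurePreserving (fun (t : Fin l → ℝ) (i : Fin l) => ((t i : ℝ) : UnitAddCircle))
      (volume.restrict (Set.Icc (0 : Fin l → ℝ) 1)) volume := by
    have h := measurePreserving_pi (fun _ : Fin l => volume.restrict (Set.Ioc (0 : ℝ) (0 + 1)))
      (fun _ : Fin l => (volume : Measure UnitAddCircle))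
      (fun i => UnitAddCircle.measurePreserving_mk 0)
    rw [← Measure.restrict_pi_pi] at h
    have h' : (Measure.pi fun _ : Fin l => (volume : Measure ℝ)).restrict
        (Set.univ.pi fun _ => Set.Ioc (0 : ℝ) (0 + 1)) = volume.restrict (Set.Icc (0 : Fin l → ℝ) 1) := by
      rw [volume_pi]
      apply Measure.restrict_congr_set
      have := Measure.univ_pi_Ioc_ae_eq_Icc (μ := fun _ : Fin l => (volume : Measure ℝ)) (f := 0) (g := 1)
      simpa using this
    rw [h'] at h
    exact h
  let φ : (Fin l → UnitAddCircle) →+ UnitAddCircle :=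
    { toFun := fun x => ∑ i, u i • x i
      map_zero' := by simp
      map_add' := fun x y => by simp [Finset.sum_add_distrib] }
  have hc : Continuous φ := by
    change Continuous (fun x : Fin l → UnitAddCircle => ∑ i, u i • x i)
    fun_prop
  obtain ⟨j, hj⟩ := Function.ne_iff.1 hu
  have hs : Function.Surjective φ := by
    intro y
    obtain ⟨y, rfl⟩ := QuotientAddGroup.mk_surjective y
    refine ⟨Pi.single j ((y / u j : ℝ) : UnitAddCircle), ?_⟩
    change ∑ i, u i • (Pi.single j ((y / u j : ℝ) : UnitAddCircle) : Fin l → UnitAddCircle) i = _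
    rw [Finset.sum_eq_single j]
    · rw [Pi.single_eq_same, ← AddCircle.coe_zsmul]
      have : u j • (y / u j) = y := by
        have : (u j : ℝ) ≠ 0 := by exact_mod_cast hj
        rw [zsmul_eq_mul]; field_simp
      rw [this]
    · intro i _ hi; rw [Pi.single_eq_of_ne hi, smul_zero]
    · simp
  have h2 : MeasurePreserving φ volume volume := by
    apply AddMonoidHom.measurePreserving hc hs
    rw [UnitAddCircle.measure_univ, volume_pi, ← Set.pi_univ Set.univ, Measure.pi_pi]
    simp
  have h3 := h2.comp h1
  convert h3 using 1
  funext t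
  change _ = ∑ i, u i • ((t i : ℝ) : UnitAddCircle)
  simp only [← AddCircle.coe_zsmul, dot, zsmul_eq_mul]
  exact map_sum (QuotientAddGroup.mk' (AddSubgroup.zmultiples (1 : ℝ))) _ _

lemma vol_cube (l : ℕ) : volume (Set.Icc (0 : Fin l → ℝ) 1) = 1 := by
  rw [Real.volume_Icc_pi]; simp

/-- The standard parametrisation of the unit circle. -/
def cpar (x : ℝ) : ℂ := Complex.exp (2 * Real.pi * Complex.I * (x : ℂ))

lemma continuous_cpar : Continuous cpar := by unfold cpar; fun_prop

lemma ech_eq_cpar {l : ℕ} (u : Fin l → ℤ) (t : Fin l → ℝ) : ech u t = cpar (dot u t) := rfl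

lemma fourier_one_cpar (x : ℝ) : fourier 1 (x : UnitAddCircle) = cpar x := by
  rw [fourier_coe_apply]; simp [cpar]

lemma map_ech {l : ℕ} (u : Fin l → ℤ) (hu : u ≠ 0) :
    Measure.map (ech u) (volume.restrict (Set.Icc (0 : Fin l → ℝ) 1)) =
      Measure.map cpar (volume.restrict (Set.Ioc (0 : ℝ) 1)) := by
  have hm : Measurable (fun z : UnitAddCircle => (fourier 1 z : ℂ)) := (map_continuous _).measurable
  have h1 := (mp_dot u hu).map_eq
  have h2 := (UnitAddCircle.measurePreserving_mk 0).map_eq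
  rw [zero_add] at h2
  have h3 := h1.trans h2.symm
  have h4 := congrArg (Measure.map (fun z : UnitAddCircle => (fourier 1 z : ℂ))) h3
  rw [Measure.map_map hm (mp_dot u hu).measurable, Measure.map_map hm
    (UnitAddCircle.measurePreserving_mk 0).measurable] at h4
  simpa only [Function.comp_def, fourier_one_cpar, ← ech_eq_cpar] using h4

lemma integral_ech {l : ℕ} {E : Type*} [NormedAddCommGroup E] [NormedSpace ℝ E]
    (u : Fin l → ℤ) (hu : u ≠ 0) (f : ℂ → E) (hf : StronglyMeasurable f) :
    ∫ t in Set.Icc (0 : Fin l → ℝ) 1, f (ech u t) = ∫ x in (0 : ℝ)..1, f (cpar x) := by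
  rw [intervalIntegral.integral_of_le zero_le_one,
    ← integral_map (continuous_ech u).aemeasurable hf.aestronglyMeasurable,
    ← integral_map continuous_cpar.aemeasurable hf.aestronglyMeasurable, map_ech u hu]

lemma integrable_ech {l : ℕ} {E : Type*} [NormedAddCommGroup E]
    (u : Fin l → ℤ) (hu : u ≠ 0) (f : ℂ → E) (hf : StronglyMeasurable f)
    (h : IntervalIntegrable (fun x => f (cpar x)) volume 0 1) :
    IntegrableOn (fun t => f (ech u t)) (Set.Icc (0 : Fin l → ℝ) 1) := by
  rw [intervalIntegrable_iff_integrableOn_Ioc_of_le zero_le_one] at h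
  have h1 := (integrable_map_measure hf.aestronglyMeasurable continuous_cpar.aemeasurable).2 h
  rw [← map_ech u hu] at h1
  exact (integrable_map_measure hf.aestronglyMeasurable (continuous_ech u).aemeasurable).1 h1

lemma integral_cpar_pow (n : ℤ) (hn : n ≠ 0) :
    ∫ x in (0 : ℝ)..1, Complex.exp (2 * Real.pi * Complex.I * ((n * x : ℝ) : ℂ)) = 0 := by
  have hc : (2 * Real.pi * Complex.I * n : ℂ) ≠ 0 := by
    simp [Real.pi_ne_zero, hn]
  have h := integral_exp_mul_complex (a := 0) (b := 1) hc
  have h2 : Complex.exp (2 * Real.pi * Complex.I * n) = 1 := by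
    rw [Complex.exp_eq_one_iff]; exact ⟨n, by ring⟩
  have h3 : ∀ x : ℝ, (2 * Real.pi * Complex.I * ((n * x : ℝ) : ℂ)) = 2 * Real.pi * Complex.I * n * x := by
    intro x; push_cast; ring
  simp only [h3]
  rw [h]
  simp [h2]

lemma integral_ech_eq_zero {l : ℕ} (u : Fin l → ℤ) (hu : u ≠ 0) :
    ∫ t in Set.Icc (0 : Fin l → ℝ) 1, ech u t = 0 := by
  have h := integral_ech u hu (fun z => z) stronglyMeasurable_id
  rw [h]
  have := integral_cpar_pow 1 one_ne_zero
  simpa [cpar] using this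

/-- One-dimensional integrals of polynomials. -/
lemma cpar_circleMap (x : ℝ) : cpar x = circleMap 0 1 (2 * Real.pi * x) := by
  simp only [cpar, circleMap]
  push_cast
  simp only [one_mul, zero_add]
  ring_nf

lemma integrable_log_cpar (p : ℂ[X]) :
    IntervalIntegrable (fun x => Real.log ‖p.eval (cpar x)‖) volume 0 1 := by
  have h := p.intervalIntegrable_mahlerMeasure
  have h2 := h.comp_mul_left (c := 2 * Real.pi)
  simp only [cpar_circleMap]
  have hpi : (2 * Real.pi) ≠ 0 := by positivity
  simpa [hpi] using h2

lemma integral_log_cpar (p : ℂ[X]) :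
    ∫ x in (0 : ℝ)..1, Real.log ‖p.eval (cpar x)‖ = p.logMahlerMeasure := by
  have hpi : (2 * Real.pi) ≠ 0 := by positivity
  simp only [cpar_circleMap]
  rw [intervalIntegral.integral_comp_mul_left (fun y => Real.log ‖p.eval (circleMap 0 1 y)‖) hpi]
  simp [Polynomial.logMahlerMeasure, Real.circleAverage]

lemma countable_zeros (p : ℂ[X]) (hp : p ≠ 0) : {x : ℝ | p.eval (cpar x) = 0}.Countable := by
  have h1 : {z : ℂ | p.IsRoot z}.Countable := (Polynomial.finite_setOfPred_isRoot hp).countable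
  have h2 := h1.preimage_cexp
  have hinj : Function.Injective (fun x : ℝ => (2 * Real.pi * Complex.I * (x : ℂ))) := by
    intro x y hxy
    have hc : (2 * Real.pi * Complex.I : ℂ) ≠ 0 := by simp [Real.pi_ne_zero]
    have := mul_left_cancel₀ hc hxy
    exact_mod_cast this
  exact h2.preimage hinj

lemma ae_ne_zero (p : ℂ[X]) (hp : p ≠ 0) : ∀ᵐ x : ℝ, p.eval (cpar x) ≠ 0 := by
  have := (countable_zeros p hp).ae_notMem (volume : Measure ℝ)
  filter_upwards [this] with x hx using hx

/-- One-dimensional trigonometric sums as polynomials. -/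
lemma one_dim {ι : Type} [Fintype ι] (b : ι → ℂ) (n : ι → ℤ) (M : ℤ) (hM : ∀ i, M ≤ n i) (x : ℝ) :
    ∑ i, b i * Complex.exp (2 * Real.pi * Complex.I * ((x * n i : ℝ) : ℂ)) =
      cpar x ^ M * (∑ i, C (b i) * X ^ (n i - M).toNat : ℂ[X]).eval (cpar x) := by
  rw [eval_finsetSum, Finset.mul_sum]
  apply Finset.sum_congr rfl
  intro i _
  have h0 : cpar x ≠ 0 := Complex.exp_ne_zero _
  simp only [eval_mul, eval_C, eval_pow, eval_X]
  rw [← zpow_natCast, Int.toNat_of_nonneg (sub_nonneg.2 (hM i)), mul_left_comm, ← zpow_add₀ h0,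
    add_sub_cancel, cpar, ← Complex.exp_int_mul]
  congr 2
  push_cast; ring

lemma norm_cpar (x : ℝ) : ‖cpar x‖ = 1 := by
  have := norm_ech (fun _ : Fin 1 => 1) (fun _ => x)
  simpa [ech_eq_cpar, dot] using this

lemma one_dim_norm {ι : Type} [Fintype ι] (b : ι → ℂ) (n : ι → ℤ) (M : ℤ) (hM : ∀ i, M ≤ n i) (x : ℝ) :
    ‖∑ i, b i * Complex.exp (2 * Real.pi * Complex.I * ((x * n i : ℝ) : ℂ))‖ =
      ‖(∑ i, C (b i) * X ^ (n i - M).toNat : ℂ[X]).eval (cpar x)‖ := by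
  rw [one_dim b n M hM, norm_mul, norm_zpow, norm_cpar, one_zpow, one_mul]

lemma one_dim_ne_zero {ι : Type} [Fintype ι] (b : ι → ℂ) (n : ι → ℤ) (M : ℤ) (hM : ∀ i, M ≤ n i)
    (hn : Function.Injective n) (i : ι) (hi : b i ≠ 0) :
    (∑ i, C (b i) * X ^ (n i - M).toNat : ℂ[X]) ≠ 0 := by
  classical
  intro h
  have := congrArg (fun p : ℂ[X] => p.coeff (n i - M).toNat) h
  simp only [finsetSum_coeff, coeff_C_mul, coeff_X_pow, coeff_zero] at this
  rw [Finset.sum_eq_single i] at this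
  · simp [hi] at this
  · intro j _ hj
    have h1 : n i ≠ n j := fun h => hj (hn h).symm
    have := hM i
    have := hM j
    rw [if_neg (by omega), mul_zero]
  · simp

/-- The generic direction. -/
def sdir (l : ℕ) (n : ℕ) : Fin l → ℝ := fun i => (n : ℝ) ^ (i : ℕ)

/-- Integer pairing with the generic direction. -/
def idir {l : ℕ} (n : ℕ) (u : Fin l → ℤ) : ℤ := ∑ i, u i * (n : ℤ) ^ (i : ℕ)

lemma dot_sdir {l : ℕ} (n : ℕ) (u : Fin l → ℤ) : dot u (sdir l n) = (idir n u : ℝ) := by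
  simp [dot, sdir, idir]

lemma idir_eventually {l : ℕ} (u : Fin l → ℤ) (hu : u ≠ 0) : ∀ᶠ n : ℕ in Filter.atTop, idir n u ≠ 0 := by
  set p : ℤ[X] := ∑ i, C (u i) * X ^ (i : ℕ) with hp
  have hp0 : p ≠ 0 := by
    obtain ⟨j, hj⟩ := Function.ne_iff.1 hu
    intro h
    have := congrArg (fun q : ℤ[X] => q.coeff j) h
    simp only [hp, finsetSum_coeff, coeff_C_mul, coeff_X_pow, coeff_zero] at this
    rw [Finset.sum_eq_single j] at this
    · simp at this; exact hj this
    · intro i _ hij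
      rw [if_neg (fun h => hij (Fin.ext h.symm)), mul_zero]
    · simp
  have hfin : {n : ℕ | idir n u = 0}.Finite := by
    have h1 : {z : ℤ | p.IsRoot z}.Finite := Polynomial.finite_setOfPred_isRoot hp0
    have h2 := h1.preimage (f := fun n : ℕ => (n : ℤ)) (Nat.cast_injective.injOn)
    refine h2.subset ?_
    intro n hn
    change p.eval (n : ℤ) = 0
    rw [hp, eval_finsetSum]
    simpa [idir] using hn
  have := hfin.eventually_cofinite_notMem
  rw [Nat.cofinite_eq_atTop] at this
  exact this

lemma idir_add {l : ℕ} (n : ℕ) (u v : Fin l → ℤ) : idir n (u + v) = idir n u + idir n v := by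
  simp [idir, add_mul, Finset.sum_add_distrib]

lemma idir_sub {l : ℕ} (n : ℕ) (u v : Fin l → ℤ) : idir n (u - v) = idir n u - idir n v := by
  simp [idir, sub_mul, Finset.sum_sub_distrib]

lemma idir_smul {l : ℕ} (n : ℕ) (m : ℤ) (u : Fin l → ℤ) : idir n (m • u) = m * idir n u := by
  simp [idir, mul_assoc, Finset.mul_sum]
end ZIso

namespace ZIso
open Polynomial

/-- Trigonometric polynomials. -/
def Trig (l : ℕ) : Submodule ℂ ((Fin l → ℝ) → ℂ) := Submodule.span ℂ (Set.range ech)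

lemma ech_mem {l : ℕ} (u : Fin l → ℤ) : ech u ∈ Trig l := Submodule.subset_span ⟨u, rfl⟩

lemma one_mem_Trig (l : ℕ) : (1 : (Fin l → ℝ) → ℂ) ∈ Trig l := by
  have h : (1 : (Fin l → ℝ) → ℂ) = ech 0 := by funext t; simp [ech_zero]
  rw [h]; exact ech_mem 0

lemma mul_mem_Trig {l : ℕ} {f g : (Fin l → ℝ) → ℂ} (hf : f ∈ Trig l) (hg : g ∈ Trig l) :
    f * g ∈ Trig l := by
  have h := Submodule.mul_mem_mul hf hg
  rw [Trig, Submodule.span_mul_span] at h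
  refine Submodule.span_mono ?_ h
  rintro _ ⟨_, ⟨u, rfl⟩, _, ⟨v, rfl⟩, rfl⟩
  exact ⟨u + v, by funext t; exact ech_add u v t⟩

lemma pow_mem_Trig {l : ℕ} {f : (Fin l → ℝ) → ℂ} (hf : f ∈ Trig l) (n : ℕ) : f ^ n ∈ Trig l := by
  induction n with
  | zero => rw [pow_zero]; exact one_mem_Trig l
  | succ n ih => rw [pow_succ]; exact mul_mem_Trig ih hf

lemma aeval_mem_Trig {l : ℕ} {f : (Fin l → ℝ) → ℂ} (hf : f ∈ Trig l) (q : ℂ[X]) :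
    (fun t => q.eval (f t)) ∈ Trig l := by
  have h : (fun t => q.eval (f t)) = ∑ i ∈ q.support, q.coeff i • f ^ i := by
    funext t
    rw [Finset.sum_apply, eval_eq_sum, Polynomial.sum]
    rfl
  rw [h]
  exact Submodule.sum_mem _ fun i _ => Submodule.smul_mem _ _ (pow_mem_Trig hf i)

lemma conj_mem_Trig {l : ℕ} {f : (Fin l → ℝ) → ℂ} (hf : f ∈ Trig l) :
    (fun t => (starRingEnd ℂ) (f t)) ∈ Trig l := by
  induction hf using Submodule.span_induction with
  | mem x hx =>
    obtain ⟨u, rfl⟩ := hx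
    simp only [conj_ech]
    exact ech_mem (-u)
  | zero => simp only [Pi.zero_apply, map_zero]; exact (Trig l).zero_mem
  | add x y _ _ h1 h2 => simp only [Pi.add_apply, map_add]; exact (Trig l).add_mem h1 h2
  | smul a x _ h1 => simp only [Pi.smul_apply, smul_eq_mul, map_mul]; exact (Trig l).smul_mem ((starRingEnd ℂ) a) h1

lemma continuous_Trig {l : ℕ} {f : (Fin l → ℝ) → ℂ} (hf : f ∈ Trig l) : Continuous f := by
  induction hf using Submodule.span_induction with
  | mem x hx =>
    obtain ⟨u, rfl⟩ := hx
    exact continuous_ech u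
  | zero => exact continuous_const
  | add x y _ _ h1 h2 => exact h1.add h2
  | smul a x _ h1 => exact h1.const_smul a

lemma bounded_Trig {l : ℕ} {f : (Fin l → ℝ) → ℂ} (hf : f ∈ Trig l) : ∃ L : ℝ, ∀ t, ‖f t‖ ≤ L := by
  induction hf using Submodule.span_induction with
  | mem x hx =>
    obtain ⟨u, rfl⟩ := hx
    exact ⟨1, fun t => (norm_ech u t).le⟩
  | zero => exact ⟨0, fun t => by simp⟩
  | add x y _ _ h1 h2 =>
    obtain ⟨L1, h1⟩ := h1
    obtain ⟨L2, h2⟩ := h2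
    exact ⟨L1 + L2, fun t => (norm_add_le _ _).trans (add_le_add (h1 t) (h2 t))⟩
  | smul a x _ h1 =>
    obtain ⟨L1, h1⟩ := h1
    exact ⟨‖a‖ * L1, fun t => (norm_smul_le _ _).trans (mul_le_mul_of_nonneg_left (h1 t) (norm_nonneg a))⟩

lemma integrable_cube {l : ℕ} {E : Type*} [NormedAddCommGroup E] {f : (Fin l → ℝ) → E}
    (hf : Continuous f) : IntegrableOn f (Set.Icc (0 : Fin l → ℝ) 1) :=
  hf.continuousOn.integrableOn_compact isCompact_Icc

lemma integral_Trig {l : ℕ} {f : (Fin l → ℝ) → ℂ} (hf : f ∈ Trig l) :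
    ∀ᶠ n : ℕ in Filter.atTop, ∫ x in (0 : ℝ)..1, f (x • sdir l n) =
      ∫ t in Set.Icc (0 : Fin l → ℝ) 1, f t := by
  have hline : ∀ (g : (Fin l → ℝ) → ℂ), g ∈ Trig l → ∀ n : ℕ,
      IntervalIntegrable (fun x : ℝ => g (x • sdir l n)) volume 0 1 := by
    intro g hg n
    have := continuous_Trig hg
    exact (by fun_prop : Continuous (fun x : ℝ => g (x • sdir l n))).intervalIntegrable _ _
  induction hf using Submodule.span_induction with
  | mem x hx =>
    obtain ⟨u, rfl⟩ := hx
    by_cases hu : u = 0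
    · subst hu
      simp [ech_zero, Measure.real, vol_cube]
    · filter_upwards [idir_eventually u hu] with n hn
      rw [integral_ech_eq_zero u hu, ← integral_cpar_pow (idir n u) hn]
      simp only [ech, dot_smul_right, dot_sdir, mul_comm]
  | zero => simp
  | add x y hx hy h1 h2 =>
    filter_upwards [h1, h2] with n h1 h2
    simp only [Pi.add_apply]
    rw [intervalIntegral.integral_add (hline x hx n) (hline y hy n), h1, h2,
      integral_add (integrable_cube (continuous_Trig hx)) (integrable_cube (continuous_Trig hy))]
  | smul a x hx h1 =>
    filter_upwards [h1] with n h1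
    simp only [Pi.smul_apply]
    rw [intervalIntegral.integral_smul, integral_smul, h1]

/-- Zero sets of trigonometric sums with distinct frequencies are null. -/
lemma null_zeros {l : ℕ} {ι : Type} [Fintype ι] (b : ι → ℂ) (u : ι → Fin l → ℤ)
    (hu : Function.Injective u) (i : ι) (hi : b i ≠ 0) :
    ∀ᵐ t : Fin l → ℝ, ∑ i, b i * ech (u i) t ≠ 0 := by
  classical
  set G : (Fin l → ℝ) → ℂ := fun t => ∑ i, b i * ech (u i) t with hG
  have hGc : Continuous G := by
    apply continuous_finsetSum
    intro i _
    exact continuous_const.mul (continuous_ech _)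
  obtain ⟨n, hn⟩ : ∃ n : ℕ, ∀ i j, i ≠ j → idir n (u i - u j) ≠ 0 := by
    have : ∀ᶠ n : ℕ in Filter.atTop, ∀ i j, i ≠ j → idir n (u i - u j) ≠ 0 := by
      rw [Filter.eventually_all]; intro i
      rw [Filter.eventually_all]; intro j
      by_cases hij : i = j
      · simp [hij]
      · filter_upwards [idir_eventually (u i - u j) (sub_ne_zero.2 (fun h => hij (hu h)))] with n hn _
        exact hn
    exact this.exists
  have hinj : Function.Injective (fun i => idir n (u i)) := by
    intro i j hij
    by_contra h
    apply hn i j h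
    rw [idir_sub]; simpa using sub_eq_zero.2 hij
  obtain ⟨M, hM⟩ : ∃ M : ℤ, ∀ i, M ≤ idir n (u i) := by
    obtain ⟨M, hM⟩ := (Set.finite_range (fun i => idir n (u i))).bddBelow
    exact ⟨M, fun i => hM ⟨i, rfl⟩⟩
  set s := sdir l n with hs
  set Z : Set (Fin l → ℝ) := {t | G t = 0} with hZ
  have hZm : MeasurableSet Z := (isClosed_eq hGc continuous_const).measurableSet
  have hline : ∀ t, volume {x : ℝ | t + x • s ∈ Z} = 0 := by
    intro t
    have h1 : ∀ x : ℝ, G (t + x • s) = ∑ i, (b i * ech (u i) t) *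
        Complex.exp (2 * Real.pi * Complex.I * ((x * (idir n (u i) : ℤ) : ℝ) : ℂ)) := by
      intro x
      apply Finset.sum_congr rfl
      intro i _
      rw [mul_assoc, ech, ech, dot_add_right, dot_smul_right, dot_sdir, ← Complex.exp_add]
      congr 2
      push_cast; ring
    have hne := one_dim_ne_zero (fun i => b i * ech (u i) t) (fun i => idir n (u i)) M hM hinj i
      (mul_ne_zero hi (Complex.exp_ne_zero _))
    have h2 := ae_ne_zero _ hne
    rw [ae_iff] at h2
    convert h2 using 2
    ext x
    change G (t + x • s) = 0 ↔ ¬ (_ ≠ _)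
    rw [not_not, h1, ← norm_eq_zero, one_dim_norm _ _ M hM, norm_eq_zero]
  have hswap : ∫⁻ x in Set.Icc (0 : ℝ) 1, ∫⁻ t : Fin l → ℝ, Z.indicator (1 : (Fin l → ℝ) → ENNReal) (t + x • s) =
      ∫⁻ t : Fin l → ℝ, ∫⁻ x in Set.Icc (0 : ℝ) 1, Z.indicator (1 : (Fin l → ℝ) → ENNReal) (t + x • s) := by
    apply lintegral_lintegral_swap
    apply Measurable.aemeasurable
    have : Measurable (Z.indicator (1 : (Fin l → ℝ) → ENNReal)) := measurable_one.indicator hZm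
    apply this.comp
    fun_prop
  have hL : ∀ x : ℝ, ∫⁻ t : Fin l → ℝ, Z.indicator (1 : (Fin l → ℝ) → ENNReal) (t + x • s) = volume Z := by
    intro x
    rw [lintegral_add_right_eq_self (fun t => Z.indicator (1 : (Fin l → ℝ) → ENNReal) t), lintegral_indicator_one hZm]
  have hR : ∀ t, ∫⁻ x in Set.Icc (0 : ℝ) 1, Z.indicator (1 : (Fin l → ℝ) → ENNReal) (t + x • s) = 0 := by
    intro t
    rw [lintegral_eq_zero_iff']
    · apply ae_restrict_of_ae
      have : ∀ᵐ x : ℝ, ¬ (t + x • s ∈ Z) := by rw [ae_iff]; simpa using hline t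
      filter_upwards [this] with x hx
      simp [hx]
    · have : Measurable (Z.indicator (1 : (Fin l → ℝ) → ENNReal)) := measurable_one.indicator hZm
      exact (this.comp (by fun_prop)).aemeasurable
  simp only [hL, hR] at hswap
  simp at hswap
  rw [ae_iff]
  simpa [hZ] using hswap

lemma Trig_dich {l : ℕ} {f : (Fin l → ℝ) → ℂ} (hf : f ∈ Trig l) :
    f = 0 ∨ ∀ᵐ t : Fin l → ℝ, f t ≠ 0 := by
  rw [Trig, Finsupp.mem_span_range_iff_exists_finsupp] at hf
  obtain ⟨c, rfl⟩ := hf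
  by_cases hc : c = 0
  · left; simp [hc]
  right
  obtain ⟨i, hi⟩ := Finsupp.support_nonempty_iff.2 hc
  have := null_zeros (fun i : c.support => c i) (fun i => (i : Fin l → ℤ)) Subtype.val_injective ⟨i, hi⟩
    (Finsupp.mem_support_iff.1 hi)
  filter_upwards [this] with t ht
  rw [Finsupp.sum, Finset.sum_apply, ← Finset.sum_coe_sort]
  exact ht

lemma usc1 {l : ℕ} {G : (Fin l → ℝ) → ℂ} (hG : G ∈ Trig l) (c δ : ℝ) (hδ : 0 < δ)
    (hfreq : ∃ᶠ n : ℕ in Filter.atTop, (∀ᵐ x : ℝ, G (x • sdir l n) ≠ 0) ∧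
      IntervalIntegrable (fun x : ℝ => Real.log ‖G (x • sdir l n)‖) volume 0 1 ∧
      c ≤ ∫ x in (0 : ℝ)..1, Real.log ‖G (x • sdir l n)‖) :
    c ≤ ∫ t in Set.Icc (0 : Fin l → ℝ) 1, Real.log (max ‖G t‖ δ) := by
  have hGc := continuous_Trig hG
  obtain ⟨L, hL⟩ := bounded_Trig hG
  apply le_of_forall_pos_le_add
  intro η hη
  let h : ℝ → ℝ := fun y => Real.log (max (Real.sqrt y) δ)
  have hpos : ∀ y : ℝ, max y δ ≠ 0 := fun y => (lt_max_of_lt_right hδ).ne'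
  have hc : Continuous h := by
    apply Continuous.log
    · fun_prop
    · intro y; exact hpos _
  obtain ⟨q, hq⟩ := exists_polynomial_near_of_continuousOn 0 (L ^ 2) h hc.continuousOn (η / 2)
    (by positivity)
  have hhG : ∀ t, h (‖G t‖ ^ 2) = Real.log (max ‖G t‖ δ) := by
    intro t
    simp only [h]
    rw [Real.sqrt_sq (norm_nonneg _)]
  have hq' : ∀ t, |q.eval (‖G t‖ ^ 2) - Real.log (max ‖G t‖ δ)| < η / 2 := by
    intro t
    rw [← hhG]
    apply hq
    exact ⟨by positivity, by have := hL t; gcongr⟩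
  have hmem : (fun t => ((q.eval (‖G t‖ ^ 2) : ℝ) : ℂ)) ∈ Trig l := by
    have h1 := aeval_mem_Trig (mul_mem_Trig hG (conj_mem_Trig hG)) (q.map Complex.ofRealHom)
    convert h1 using 1
    funext t
    have h2 : (G * fun t => (starRingEnd ℂ) (G t)) t = Complex.ofRealHom (‖G t‖ ^ 2) := by
      simp [Pi.mul_apply, Complex.mul_conj, Complex.normSq_eq_norm_sq]
    rw [h2, eval_map, eval₂_hom]
    rfl
  have hev := integral_Trig hmem
  obtain ⟨n, ⟨hn1, hn2, hn3⟩, hn4⟩ := (hfreq.and_eventually hev).exists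
  rw [intervalIntegral.integral_ofReal, integral_complex_ofReal] at hn4
  have hn5 : ∫ x in (0 : ℝ)..1, q.eval (‖G (x • sdir l n)‖ ^ 2) =
      ∫ t in Set.Icc (0 : Fin l → ℝ) 1, q.eval (‖G t‖ ^ 2) := by exact_mod_cast hn4
  have hqc : Continuous (fun t => q.eval (‖G t‖ ^ 2)) := by fun_prop
  have hlc : Continuous (fun t => Real.log (max ‖G t‖ δ)) := by
    simp only [← hhG]
    exact hc.comp (hGc.norm.pow 2)
  have e1 : ∫ x in (0 : ℝ)..1, Real.log ‖G (x • sdir l n)‖ ≤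
      ∫ x in (0 : ℝ)..1, (q.eval (‖G (x • sdir l n)‖ ^ 2) + η / 2) := by
    apply intervalIntegral.integral_mono_ae zero_le_one hn2
    · exact (by fun_prop : Continuous fun x : ℝ => (q.eval (‖G (x • sdir l n)‖ ^ 2) + η / 2)).intervalIntegrable _ _
    · filter_upwards [hn1] with x hx
      have h1 := (abs_lt.1 (hq' (x • sdir l n))).1
      have h2 : Real.log ‖G (x • sdir l n)‖ ≤ Real.log (max ‖G (x • sdir l n)‖ δ) :=
        Real.log_le_log (norm_pos_iff.2 hx) (le_max_left _ _)
      linarith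
  have e2 : ∫ x in (0 : ℝ)..1, (q.eval (‖G (x • sdir l n)‖ ^ 2) + η / 2) =
      (∫ x in (0 : ℝ)..1, q.eval (‖G (x • sdir l n)‖ ^ 2)) + η / 2 := by
    rw [intervalIntegral.integral_add]
    · simp
    · exact (by fun_prop : Continuous fun x : ℝ => (q.eval (‖G (x • sdir l n)‖ ^ 2))).intervalIntegrable _ _
    · exact intervalIntegrable_const
  have e3 : ∫ t in Set.Icc (0 : Fin l → ℝ) 1, q.eval (‖G t‖ ^ 2) ≤
      ∫ t in Set.Icc (0 : Fin l → ℝ) 1, (Real.log (max ‖G t‖ δ) + η / 2) := by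
    apply integral_mono (integrable_cube hqc) (integrable_cube (by fun_prop))
    intro t
    have h1 := (abs_lt.1 (hq' t)).2
    dsimp only
    linarith
  have e4 : ∫ t in Set.Icc (0 : Fin l → ℝ) 1, (Real.log (max ‖G t‖ δ) + η / 2) =
      (∫ t in Set.Icc (0 : Fin l → ℝ) 1, Real.log (max ‖G t‖ δ)) + η / 2 := by
    rw [integral_add (integrable_cube hlc) (integrable_cube continuous_const)]
    simp [Measure.real, vol_cube]
  linarith

lemma usc {l : ℕ} {G : (Fin l → ℝ) → ℂ} (hG : G ∈ Trig l) (hG0 : ∀ᵐ t, G t ≠ 0) (c : ℝ)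
    (hfreq : ∃ᶠ n : ℕ in Filter.atTop, (∀ᵐ x : ℝ, G (x • sdir l n) ≠ 0) ∧
      IntervalIntegrable (fun x : ℝ => Real.log ‖G (x • sdir l n)‖) volume 0 1 ∧
      c ≤ ∫ x in (0 : ℝ)..1, Real.log ‖G (x • sdir l n)‖) :
    ∫ t in Set.Icc (0 : Fin l → ℝ) 1, Real.log ‖G t‖ = 0 ∨
    c ≤ ∫ t in Set.Icc (0 : Fin l → ℝ) 1, Real.log ‖G t‖ := by
  by_cases hInt : IntegrableOn (fun t => Real.log ‖G t‖) (Set.Icc (0 : Fin l → ℝ) 1)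
  swap
  · left; exact integral_undef hInt
  right
  have hGc := continuous_Trig hG
  have hlim : Filter.Tendsto (fun k : ℕ => ∫ t in Set.Icc (0 : Fin l → ℝ) 1,
      Real.log (max ‖G t‖ (1 / ((k : ℝ) + 1)))) Filter.atTop
      (nhds (∫ t in Set.Icc (0 : Fin l → ℝ) 1, Real.log ‖G t‖)) := by
    apply tendsto_integral_of_dominated_convergence (fun t => |Real.log ‖G t‖|)
    · intro k
      apply Measurable.aestronglyMeasurable
      apply Real.measurable_log.comp
      fun_prop
    · exact hInt.abs
    · intro k
      apply ae_restrict_of_ae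
      filter_upwards [hG0] with t ht
      have hk : (0 : ℝ) < 1 / ((k : ℝ) + 1) := by positivity
      have hk1 : 1 / ((k : ℝ) + 1) ≤ 1 := by
        rw [div_le_one (by positivity)]
        have : (0 : ℝ) ≤ k := Nat.cast_nonneg k
        linarith
      have hp : 0 < ‖G t‖ := norm_pos_iff.2 ht
      rcases le_total (1 / ((k : ℝ) + 1)) ‖G t‖ with h | h
      · rw [max_eq_left h, Real.norm_eq_abs]
      · rw [max_eq_right h, Real.norm_eq_abs]
        have h1 := Real.log_le_log hp h
        have h2 := Real.log_nonpos hk.le hk1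
        rw [abs_of_nonpos h2, abs_of_nonpos (h1.trans h2)]
        linarith
    · apply ae_restrict_of_ae
      filter_upwards [hG0] with t ht
      have hp : 0 < ‖G t‖ := norm_pos_iff.2 ht
      apply tendsto_const_nhds.congr'
      have := tendsto_one_div_add_atTop_nhds_zero_nat (𝕜 := ℝ)
      filter_upwards [this.eventually (gt_mem_nhds hp)] with k hk
      rw [max_eq_left hk.le]
  exact ge_of_tendsto' hlim (fun k => usc1 hG c _ (by positivity) hfreq)
end ZIso

namespace ZIso
open Polynomial

section Alg
variable {Γ : Type} [AddCommGroup Γ]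

/-- Evaluation of a group ring element on the torus through a homomorphism to `ℤ^l`. -/
def Ev {l : ℕ} (A : Γ →+ (Fin l → ℤ)) (t : Fin l → ℝ) : AddMonoidAlgebra ℤ Γ →ₐ[ℤ] ℂ :=
  AddMonoidAlgebra.lift ℤ ℂ Γ
    { toFun := fun γ => ech (A γ.toAdd) t
      map_one' := by simp [ech_zero]
      map_mul' := fun x y => by simp [ech_add] }

lemma Ev_single {l : ℕ} (A : Γ →+ (Fin l → ℤ)) (t : Fin l → ℝ) (γ : Γ) (a : ℤ) :
    Ev A t (AddMonoidAlgebra.single γ a) = a * ech (A γ) t := by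
  simp [Ev, AddMonoidAlgebra.lift_single]

lemma Ev_mem {l : ℕ} (A : Γ →+ (Fin l → ℤ)) (F : AddMonoidAlgebra ℤ Γ) :
    (fun t => Ev A t F) ∈ Trig l := by
  induction F using AddMonoidAlgebra.induction_linear with
  | zero => simp only [map_zero]; exact (Trig l).zero_mem
  | add x y h1 h2 => simp only [map_add]; exact (Trig l).add_mem h1 h2
  | single m r =>
    simp only [Ev_single]
    exact (Trig l).smul_mem (r : ℂ) (ech_mem (A m))

/-- The Mahler measure of the specialisation of `F` along `A`. -/
def mu {l : ℕ} (A : Γ →+ (Fin l → ℤ)) (F : AddMonoidAlgebra ℤ Γ) : ℝ :=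
  ∫ t in Set.Icc (0 : Fin l → ℝ) 1, Real.log ‖Ev A t F‖

/-- Zero is isolated among the specialisations of `F`. -/
def Good (F : AddMonoidAlgebra ℤ Γ) : Prop :=
  ∃ ε > (0 : ℝ), ∀ (l : ℕ) (A : Γ →+ (Fin l → ℤ)), mu A F ∉ Set.Ioo 0 ε

lemma Ev_comp {Γ' : Type} [AddCommGroup Γ'] {l : ℕ} (π : Γ →+ Γ') (A : Γ' →+ (Fin l → ℤ))
    (t : Fin l → ℝ) (F : AddMonoidAlgebra ℤ Γ) :
    Ev A t (AddMonoidAlgebra.mapDomainRingHom ℤ π F) = Ev (A.comp π) t F := by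
  induction F using AddMonoidAlgebra.induction_linear with
  | zero => simp
  | add x y h1 h2 => simp only [map_add, h1, h2]
  | single m r =>
    simp [Ev_single, AddMonoidAlgebra.mapDomainRingHom_apply, AddMonoidAlgebra.mapDomain_single]

lemma H1 [Module.Finite ℤ Γ] [IsAddTorsionFree Γ]
    (IH : ∀ (Γ' : Type) [AddCommGroup Γ'] [Module.Finite ℤ Γ'] [IsAddTorsionFree Γ'],
      Module.finrank ℤ Γ' < Module.finrank ℤ Γ → ∀ F' : AddMonoidAlgebra ℤ Γ', Good F')
    (F : AddMonoidAlgebra ℤ Γ) (w : Γ) (hw : w ≠ 0) :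
    ∃ ε > (0 : ℝ), ∀ (l : ℕ) (A : Γ →+ (Fin l → ℤ)), A w = 0 → mu A F ∉ Set.Ioo 0 ε := by
  set N := Submodule.span ℤ {w} with hN
  let Γ1 := Γ ⧸ N
  let Γ2 := Γ1 ⧸ Submodule.torsion ℤ Γ1
  have : IsAddTorsionFree Γ2 := by
    have : Module.IsTorsionFree ℤ Γ2 := inferInstanceAs (Module.IsTorsionFree ℤ (Γ1 ⧸ Submodule.torsion ℤ Γ1))
    exact Module.isTorsionFree_int_iff_isAddTorsionFree.1 this
  have hlt : Module.finrank ℤ Γ2 < Module.finrank ℤ Γ := by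
    have h1 := Submodule.finrank_quotient_add_finrank N
    have h2 := Submodule.finrank_quotient_add_finrank (Submodule.torsion ℤ Γ1)
    have h3 : 0 < Module.finrank ℤ N := by
      have : Nontrivial N := by
        rw [Submodule.nontrivial_iff_ne_bot, hN, Ne, Submodule.span_singleton_eq_bot]; exact hw
      exact Module.finrank_pos
    change Module.finrank ℤ (Γ1 ⧸ Submodule.torsion ℤ Γ1) < _
    change Module.finrank ℤ Γ1 + _ = _ at h1
    omega
  let π : Γ →ₗ[ℤ] Γ2 := (Submodule.mkQ (Submodule.torsion ℤ Γ1)).comp (Submodule.mkQ N)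
  obtain ⟨ε, hε, h⟩ := IH Γ2 hlt (AddMonoidAlgebra.mapDomainRingHom ℤ π.toAddMonoidHom F)
  refine ⟨ε, hε, fun l A hA => ?_⟩
  let A1 : Γ1 →ₗ[ℤ] (Fin l → ℤ) := Submodule.liftQ N A.toIntLinearMap (by
    rw [hN, Submodule.span_singleton_le_iff_mem]; exact hA)
  let A2 : Γ2 →ₗ[ℤ] (Fin l → ℤ) := Submodule.liftQ (Submodule.torsion ℤ Γ1) A1 (by
    intro x hx
    obtain ⟨a, ha⟩ := hx
    have h1 : (a : ℤ) • A1 x = 0 := by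
      rw [← map_smul]
      have : (a : ℤ) • x = 0 := ha
      rw [this, map_zero]
    have h2 : (a : ℤ) ≠ 0 := nonZeroDivisors.coe_ne_zero a
    exact (smul_eq_zero.1 h1).resolve_left h2)
  have hcomp : A2.toAddMonoidHom.comp π.toAddMonoidHom = A := by
    ext x i
    rfl
  have := h l A2.toAddMonoidHom
  rwa [mu, show (fun t => Real.log ‖Ev A2.toAddMonoidHom t (AddMonoidAlgebra.mapDomainRingHom ℤ π.toAddMonoidHom F)‖)
    = fun t => Real.log ‖Ev A t F‖ by funext t; rw [Ev_comp, hcomp]] at this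

lemma Ev_aeval {l : ℕ} (A : Γ →+ (Fin l → ℤ)) (t : Fin l → ℝ) (v : Γ) (p : ℤ[X]) :
    Ev A t (aeval (AddMonoidAlgebra.single v (1 : ℤ)) p) = (toC p).eval (ech (A v) t) := by
  rw [← Polynomial.aeval_algHom_apply, Ev_single, Int.cast_one, one_mul, aeval_def, eval_map]
  rfl

/-- The cyclotomic polynomial at a monomial. -/
def cyc (d : ℕ) (v : Γ) : AddMonoidAlgebra ℤ Γ :=
  aeval (AddMonoidAlgebra.single v (1 : ℤ)) (cyclotomic d ℤ)

lemma cyc_not_unit {l : ℕ} (A : Γ →+ (Fin l → ℤ)) (d : ℕ) (hd : 0 < d) (v : Γ) (hv : A v ≠ 0) :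
    ¬ IsUnit (cyc d v) := by
  intro h
  obtain ⟨j, hj⟩ := Function.ne_iff.1 hv
  have hj' : (A v j : ℝ) ≠ 0 := by exact_mod_cast hj
  have hd' : (d : ℝ) ≠ 0 := by positivity
  set t : Fin l → ℝ := Pi.single j (1 / (d * A v j)) with ht
  have hdot : dot (A v) t = 1 / d := by
    rw [dot, Finset.sum_eq_single j]
    · rw [ht, Pi.single_eq_same]; field_simp
    · intro i _ hi; rw [ht, Pi.single_eq_of_ne hi, mul_zero]
    · simp
  have h1 := h.map (Ev A t)
  apply h1.ne_zero
  rw [cyc, Ev_aeval, toC, map_cyclotomic, ech, hdot]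
  have h2 := Complex.isPrimitiveRoot_exp d hd.ne'
  have h3 := h2.isRoot_cyclotomic hd
  have h4 : (2 * Real.pi * Complex.I * ((1 / d : ℝ) : ℂ)) = 2 * Real.pi * Complex.I / d := by
    push_cast; ring
  rw [h4]
  exact h3

lemma mu_cyc_mul {l : ℕ} (A : Γ →+ (Fin l → ℤ)) (d : ℕ) (v : Γ) (hv : A v ≠ 0)
    (F : AddMonoidAlgebra ℤ Γ) : mu A (cyc d v * F) = 0 ∨ mu A (cyc d v * F) = mu A F := by
  rcases Trig_dich (Ev_mem A (cyc d v * F)) with h | h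
  · left
    have : ∀ t, Ev A t (cyc d v * F) = 0 := fun t => congrFun h t
    simp [mu, this]
  right
  have hms : StronglyMeasurable (fun z : ℂ => Real.log ‖(toC (cyclotomic d ℤ)).eval z‖) := by
    apply Measurable.stronglyMeasurable
    apply Real.measurable_log.comp
    exact ((toC (cyclotomic d ℤ)).continuous.norm).measurable
  have hI := integrable_ech (A v) hv _ hms (integrable_log_cpar _)
  have hi := integral_ech (A v) hv _ hms
  rw [integral_log_cpar] at hi
  have hz : (toC (cyclotomic d ℤ)).logMahlerMeasure = 0 := by
    have h1 := Polynomial.cyclotomic_mahlerMeasure_eq_one (R := ℤ) d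
    rw [logMahlerMeasure_eq_log_MahlerMeasure]
    change Real.log (mahlerMeasure (Polynomial.map (algebraMap ℤ ℂ) (cyclotomic d ℤ))) = 0
    rw [h1, Real.log_one]
  rw [hz] at hi
  have hae : (fun t => Real.log ‖Ev A t (cyc d v * F)‖) =ᵐ[volume.restrict (Set.Icc (0 : Fin l → ℝ) 1)]
      fun t => Real.log ‖(toC (cyclotomic d ℤ)).eval (ech (A v) t)‖ + Real.log ‖Ev A t F‖ := by
    apply ae_restrict_of_ae
    filter_upwards [h] with t ht
    rw [map_mul] at ht ⊢
    rw [norm_mul, Real.log_mul (norm_ne_zero_iff.2 (left_ne_zero_of_mul ht))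
      (norm_ne_zero_iff.2 (right_ne_zero_of_mul ht)), cyc, Ev_aeval]
  rw [mu, integral_congr_ae hae, mu]
  by_cases hF : IntegrableOn (fun t => Real.log ‖Ev A t F‖) (Set.Icc (0 : Fin l → ℝ) 1)
  · rw [integral_add hI hF, hi, zero_add]
  · rw [integral_undef hF, integral_undef]
    intro hh
    apply hF
    have := hh.sub hI
    refine this.congr ?_
    filter_upwards with t
    simp

lemma H2 (F : AddMonoidAlgebra ℤ Γ) [IsDomain (AddMonoidAlgebra ℤ Γ)]
    (IH : ∀ F' : AddMonoidAlgebra ℤ Γ, DvdNotUnit F' F → Good F') (v : Γ) (d : ℕ) (hd : 0 < d) :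
    ∃ ε > (0 : ℝ), ∀ (l : ℕ) (A : Γ →+ (Fin l → ℤ)), A v ≠ 0 → cyc d v ∣ F → mu A F ∉ Set.Ioo 0 ε := by
  by_cases h : ∃ (l : ℕ) (A : Γ →+ (Fin l → ℤ)), A v ≠ 0
  swap
  · exact ⟨1, one_pos, fun l A hA => absurd ⟨l, A, hA⟩ h⟩
  obtain ⟨l0, A0, hA0⟩ := h
  by_cases hdvd : cyc d v ∣ F
  swap
  · exact ⟨1, one_pos, fun l A hA h => absurd h hdvd⟩
  by_cases hF : F = 0
  · refine ⟨1, one_pos, fun l A _ _ => ?_⟩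
    simp [hF, mu]
  obtain ⟨F', rfl⟩ := hdvd
  have hF' : F' ≠ 0 := right_ne_zero_of_mul hF
  obtain ⟨ε, hε, h⟩ := IH F' ⟨hF', cyc d v, cyc_not_unit A0 d hd v hA0, mul_comm _ _⟩
  refine ⟨ε, hε, fun l A hA _ => ?_⟩
  rcases mu_cyc_mul A d v hA F' with h1 | h1
  · rw [h1]; simp
  · rw [h1]; exact h l A

lemma Good_single (γ : Γ) (a : ℤ) : Good (AddMonoidAlgebra.single γ a) := by
  refine ⟨Real.log 2, Real.log_pos (by norm_num), fun l A => ?_⟩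
  have h1 : mu A (AddMonoidAlgebra.single γ a) = Real.log |(a : ℝ)| := by
    simp [mu, Ev_single, norm_ech, Measure.real, vol_cube]
  rw [h1]
  rintro ⟨h2, h3⟩
  have ha : a ≠ 0 := by rintro rfl; simp at h2
  have h4 : (1 : ℝ) < |(a : ℝ)| := by
    by_contra! h
    have := Real.log_nonpos (abs_nonneg _) h
    linarith
  have h5 : |(a : ℝ)| < 2 := by
    by_contra! h
    have := Real.log_le_log (by norm_num) h
    linarith
  have h6 : 1 < |a| := by exact_mod_cast h4
  have h7 : |a| < 2 := by exact_mod_cast h5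
  omega

lemma single_zsmul (v : Γ) (n : ℕ) :
    (AddMonoidAlgebra.single v (1 : ℤ)) ^ n = AddMonoidAlgebra.single (n • v) 1 := by
  simp [AddMonoidAlgebra.single_pow]

lemma cyc_dvd {ι : Type} [Fintype ι] [DecidableEq ι] (a : ι → ℤ) (e : ι → Γ) (r : Finset (ι × ι))
    (m : ι × ι → ℤ) (B : ℕ) (hB : ∀ p, |m p| ≤ B) (v : Γ) (β : ℂ) (d : ℕ) (hd : 0 < d)
    (hβ : IsPrimitiveRoot β d)
    (h1 : ∀ i, (i, i) ∈ r) (h2 : ∀ i j, (i, j) ∈ r → (j, i) ∈ r)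
    (h3 : ∀ i j k, (i, j) ∈ r → (j, k) ∈ r → (i, k) ∈ r)
    (he : ∀ i j, (i, j) ∈ r → e j - e i = m (i, j) • v)
    (hs : ∀ i, ∑ j, (if (i, j) ∈ r then (a j : ℂ) * β ^ m (i, j) else 0) = 0) :
    cyc d v ∣ ∑ i, AddMonoidAlgebra.single (e i) (a i) := by
  classical
  have hβ0 : β ≠ 0 := hβ.ne_zero hd.ne'
  have hblock : ∀ i, cyc d v ∣ ∑ j, (if (i, j) ∈ r then AddMonoidAlgebra.single (e j) (a j) else 0) := by
    intro i
    set p : ℤ[X] := ∑ j, (if (i, j) ∈ r then C (a j) * X ^ (m (i, j) + B).toNat else 0) with hp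
    have hmB : ∀ j, 0 ≤ m (i, j) + B := fun j => by have := (abs_le.1 (hB (i, j))).1; linarith
    have hroot : aeval β p = 0 := by
      have : aeval β p = β ^ B * ∑ j, (if (i, j) ∈ r then (a j : ℂ) * β ^ m (i, j) else 0) := by
        rw [hp, map_sum, Finset.mul_sum]
        apply Finset.sum_congr rfl
        intro j _
        split_ifs with hij
        · rw [map_mul, aeval_C, map_pow, aeval_X, ← zpow_natCast β (_ : ℤ).toNat,
            Int.toNat_of_nonneg (hmB j), zpow_add₀ hβ0, zpow_natCast]
          simp only [algebraMap_int_eq, eq_intCast]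
          ring
        · simp
      rw [this, hs, mul_zero]
    have hdvd : cyclotomic d ℤ ∣ p := by
      rw [cyclotomic_eq_minpoly hβ hd]
      exact minpoly.isIntegrallyClosed_dvd (hβ.isIntegral hd) hroot
    have h4 : cyc d v ∣ aeval (AddMonoidAlgebra.single v (1 : ℤ)) p := map_dvd _ hdvd
    have h5 : ∑ j, (if (i, j) ∈ r then AddMonoidAlgebra.single (e j) (a j) else 0) =
        AddMonoidAlgebra.single (e i - B • v) (1 : ℤ) * aeval (AddMonoidAlgebra.single v (1 : ℤ)) p := by
      rw [hp, map_sum, Finset.mul_sum]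
      apply Finset.sum_congr rfl
      intro j _
      split_ifs with hij
      · rw [map_mul, aeval_C, map_pow, aeval_X, single_zsmul, ← mul_assoc, mul_comm (AddMonoidAlgebra.single _ _)
          (algebraMap _ _ _), mul_assoc, AddMonoidAlgebra.single_mul_single, ← Algebra.smul_def,
          AddMonoidAlgebra.smul_single, mul_one, smul_eq_mul, mul_one]
        congr 1
        rw [← natCast_zsmul v (_ : ℤ).toNat, Int.toNat_of_nonneg (hmB j), add_smul, ← he i j hij,
          natCast_zsmul]
        abel
      · simp
    rw [h5]
    exact h4.mul_left _
  let s : Setoid ι := ⟨fun i j => (i, j) ∈ r, h1, fun {i j} => h2 i j, fun {i j k} => h3 i j k⟩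
  rw [← Finset.sum_fiberwise Finset.univ (fun i => (Quotient.mk s i)) (fun i => AddMonoidAlgebra.single (e i) (a i))]
  apply Finset.dvd_sum
  intro q _
  have := hblock q.out
  rw [← Finset.sum_filter] at this
  convert this using 2
  ext j
  simp only [Finset.mem_filter, Finset.mem_univ, true_and]
  constructor
  · intro h
    have h5 : Quotient.mk s q.out = Quotient.mk s j := by rw [h]; exact Quotient.out_eq q
    exact Quotient.exact h5
  · intro h
    have h5 : Quotient.mk s q.out = Quotient.mk s j := Quotient.sound h
    rw [← h5]; exact Quotient.out_eq q
end Alg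
end ZIso

namespace ZIso
open Polynomial

section Main
variable {Γ : Type} [AddCommGroup Γ]

lemma ev_small {P : ∀ (l : ℕ) (_ : Γ →+ (Fin l → ℤ)), Prop} {F : AddMonoidAlgebra ℤ Γ}
    (h : ∃ ε > (0 : ℝ), ∀ (l : ℕ) (A : Γ →+ (Fin l → ℤ)), P l A → mu A F ∉ Set.Ioo 0 ε) :
    ∀ᶠ ε in nhdsWithin (0 : ℝ) (Set.Ioi 0), ∀ (l : ℕ) (A : Γ →+ (Fin l → ℤ)), P l A →
      mu A F ∉ Set.Ioo 0 ε := by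
  obtain ⟨ε0, h0, h⟩ := h
  filter_upwards [Ioo_mem_nhdsGT h0] with ε hε l A hP hmem
  exact h l A hP ⟨hmem.1, hmem.2.trans hε.2⟩

open Classical in
/-- A chosen Bezout certificate. -/
def bez {ι : Type} [Fintype ι] (r : Finset (ι × ι)) (m : ι × ι → ℤ) : ι × ι → ℤ :=
  if h : ∃ g : ι × ι → ℤ, ∑ p ∈ r, m p * g p = 1 then h.choose else 0

lemma bez_spec {ι : Type} [Fintype ι] (r : Finset (ι × ι)) (m g : ι × ι → ℤ)
    (h : ∑ p ∈ r, m p * g p = 1) : ∑ p ∈ r, m p * bez r m p = 1 := by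
  have h' : ∃ g : ι × ι → ℤ, ∑ p ∈ r, m p * g p = 1 := ⟨g, h⟩
  rw [bez, dif_pos h']
  exact h'.choose_spec

/-- The candidate direction. -/
def vdir {ι : Type} [Fintype ι] (e : ι → Γ) (r : Finset (ι × ι)) (m : ι × ι → ℤ) : Γ :=
  ∑ p ∈ r, bez r m p • (e p.2 - e p.1)

lemma idir_hom {l : ℕ} (n : ℕ) {ι : Type} (s : Finset ι) (f : ι → Fin l → ℤ) :
    idir n (∑ i ∈ s, f i) = ∑ i ∈ s, idir n (f i) := by
  classical
  induction s using Finset.induction_on with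
  | empty => simp [idir]
  | insert a s ha ih => rw [Finset.sum_insert ha, Finset.sum_insert ha, idir_add, ih]

lemma ev_idir {l : ℕ} (u : Fin l → ℤ) : ∀ᶠ n : ℕ in Filter.atTop, u ≠ 0 → idir n u ≠ 0 := by
  by_cases hu : u = 0
  · simp [hu]
  · filter_upwards [idir_eventually u hu] with n hn _ using hn

theorem step {ι : Type} [Fintype ι] [DecidableEq ι] (a : ι → ℤ) (ha : ∀ i, a i ≠ 0)
    (hcard : 2 ≤ Fintype.card ι) (e : ι → Γ) (he : Function.Injective e) (F : AddMonoidAlgebra ℤ Γ)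
    (hF : F = ∑ i, AddMonoidAlgebra.single (e i) (a i))
    (h1 : ∀ w : Γ, w ≠ 0 → ∃ ε > (0 : ℝ), ∀ (l : ℕ) (A : Γ →+ (Fin l → ℤ)), A w = 0 →
      mu A F ∉ Set.Ioo 0 ε)
    (h2 : ∀ (v : Γ) (d : ℕ), 0 < d → ∃ ε > (0 : ℝ), ∀ (l : ℕ) (A : Γ →+ (Fin l → ℤ)), A v ≠ 0 →
      cyc d v ∣ F → mu A F ∉ Set.Ioo 0 ε) : Good F := by
  obtain ⟨c, hc, B, Q, hQ, huniv⟩ := univ_lemma a ha hcard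
  have ev1 : ∀ᶠ ε in nhdsWithin (0 : ℝ) (Set.Ioi 0), ∀ i j, i ≠ j →
      ∀ (l : ℕ) (A : Γ →+ (Fin l → ℤ)), A (e i - e j) = 0 → mu A F ∉ Set.Ioo 0 ε := by
    rw [Filter.eventually_all]; intro i
    rw [Filter.eventually_all]; intro j
    by_cases hij : i = j
    · simp [hij]
    · filter_upwards [ev_small (h1 (e i - e j) (sub_ne_zero.2 (fun h => hij (he h))))] with ε hε _
      exact hε
  have ev2 : ∀ᶠ ε in nhdsWithin (0 : ℝ) (Set.Ioi 0), ∀ (r : Finset (ι × ι))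
      (m : ι × ι → (Finset.Icc (-(B : ℤ)) B : Finset ℤ)) (i j : ι),
      e j - e i - (m (i, j) : ℤ) • vdir e r (fun p => (m p : ℤ)) ≠ 0 →
      ∀ (l : ℕ) (A : Γ →+ (Fin l → ℤ)),
        A (e j - e i - (m (i, j) : ℤ) • vdir e r (fun p => (m p : ℤ))) = 0 → mu A F ∉ Set.Ioo 0 ε := by
    rw [Filter.eventually_all]; intro r
    rw [Filter.eventually_all]; intro m
    rw [Filter.eventually_all]; intro i
    rw [Filter.eventually_all]; intro j
    by_cases hw : e j - e i - (m (i, j) : ℤ) • vdir e r (fun p => (m p : ℤ)) = 0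
    · simp [hw]
    · filter_upwards [ev_small (h1 _ hw)] with ε hε _
      exact hε
  have ev3 : ∀ᶠ ε in nhdsWithin (0 : ℝ) (Set.Ioi 0), ∀ (r : Finset (ι × ι))
      (m : ι × ι → (Finset.Icc (-(B : ℤ)) B : Finset ℤ)) (d : Fin (Q + 1)), 0 < (d : ℕ) →
      ∀ (l : ℕ) (A : Γ →+ (Fin l → ℤ)), (A (vdir e r (fun p => (m p : ℤ))) ≠ 0 ∧
        cyc d (vdir e r (fun p => (m p : ℤ))) ∣ F) → mu A F ∉ Set.Ioo 0 ε := by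
    rw [Filter.eventually_all]; intro r
    rw [Filter.eventually_all]; intro m
    rw [Filter.eventually_all]; intro d
    by_cases hd : 0 < (d : ℕ)
    · obtain ⟨ε0, h0, hh⟩ := h2 (vdir e r (fun p => (m p : ℤ))) d hd
      filter_upwards [ev_small (P := fun l A => A (vdir e r (fun p => (m p : ℤ))) ≠ 0 ∧
        cyc d (vdir e r (fun p => (m p : ℤ))) ∣ F) ⟨ε0, h0, fun l A hA => hh l A hA.1 hA.2⟩] with ε hε _
      exact hε
    · simp [hd]
  obtain ⟨ε, ⟨⟨⟨hε1, hε2⟩, hε3⟩, hεc⟩⟩ := (((ev1.and ev2).and ev3).and (Ioo_mem_nhdsGT hc)).exists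
  refine ⟨ε, hεc.1, fun l A hmem => ?_⟩
  have hA1 : ∀ i j, i ≠ j → A (e i - e j) ≠ 0 := fun i j hij h => hε1 i j hij l A h hmem
  have hA2 : ∀ (r : Finset (ι × ι))
      (m : ι × ι → (Finset.Icc (-(B : ℤ)) B : Finset ℤ)) (i j : ι),
      e j - e i - (m (i, j) : ℤ) • vdir e r (fun p => (m p : ℤ)) ≠ 0 →
      A (e j - e i - (m (i, j) : ℤ) • vdir e r (fun p => (m p : ℤ))) ≠ 0 :=
    fun r m i j h h' => hε2 r m i j h l A h' hmem
  have hEv : ∀ t, Ev A t F = ∑ i, (a i : ℂ) * ech (A (e i)) t := by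
    intro t
    rw [hF, map_sum]
    exact Finset.sum_congr rfl fun i _ => Ev_single A t _ _
  have hAinj : Function.Injective (fun i => A (e i)) := by
    intro i j hij
    by_contra h
    apply hA1 i j h
    rw [map_sub]; exact sub_eq_zero.2 hij
  obtain ⟨i1, i2, hi12⟩ := Fintype.one_lt_card_iff.1 (show 1 < Fintype.card ι by omega)
  have hnull : ∀ᵐ t, Ev A t F ≠ 0 := by
    simp only [hEv]
    exact null_zeros (fun i => (a i : ℂ)) (fun i => A (e i)) hAinj i1 (by exact_mod_cast ha i1)
  have hnf : ¬ ∃ᶠ n : ℕ in Filter.atTop, (∀ᵐ x : ℝ, Ev A (x • sdir l n) F ≠ 0) ∧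
      IntervalIntegrable (fun x : ℝ => Real.log ‖Ev A (x • sdir l n) F‖) volume 0 1 ∧
      c ≤ ∫ x in (0 : ℝ)..1, Real.log ‖Ev A (x • sdir l n) F‖ := by
    intro hfreq
    rcases usc (Ev_mem A F) hnull c hfreq with h | h
    · have : mu A F = 0 := h
      rw [this] at hmem
      exact lt_irrefl _ hmem.1
    · have h' : c ≤ mu A F := h
      have := hmem.2
      have := hεc.2
      linarith
  rw [Filter.not_frequently] at hnf
  have g1 : ∀ᶠ n : ℕ in Filter.atTop, ∀ i j, i ≠ j → idir n (A (e i - e j)) ≠ 0 := by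
    rw [Filter.eventually_all]; intro i
    rw [Filter.eventually_all]; intro j
    filter_upwards [ev_idir (A (e i - e j))] with n hn hij
    exact hn (hA1 i j hij)
  have g2 : ∀ᶠ n : ℕ in Filter.atTop, ∀ (r : Finset (ι × ι))
      (m : ι × ι → (Finset.Icc (-(B : ℤ)) B : Finset ℤ)) (i j : ι),
      e j - e i - (m (i, j) : ℤ) • vdir e r (fun p => (m p : ℤ)) ≠ 0 →
      idir n (A (e j - e i - (m (i, j) : ℤ) • vdir e r (fun p => (m p : ℤ)))) ≠ 0 := by
    rw [Filter.eventually_all]; intro r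
    rw [Filter.eventually_all]; intro m
    rw [Filter.eventually_all]; intro i
    rw [Filter.eventually_all]; intro j
    filter_upwards [ev_idir (A (e j - e i - (m (i, j) : ℤ) • vdir e r (fun p => (m p : ℤ))))] with n hn hw
    exact hn (hA2 r m i j hw)
  obtain ⟨n, ⟨⟨hn, hn1⟩, hn2⟩⟩ := ((hnf.and g1).and g2).exists
  have : Nonempty ι := ⟨i1⟩
  set N : ι → ℤ := fun i => idir n (A (e i)) with hN
  obtain ⟨i0, hi0⟩ := Finite.exists_min N
  have hNinj : Function.Injective N := by
    intro i j hij
    by_contra h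
    apply hn1 i j h
    rw [map_sub, idir_sub]; exact sub_eq_zero.2 hij
  set nn : ι → ℕ := fun i => (N i - N i0).toNat with hnn
  have hnnN : ∀ i, (nn i : ℤ) = N i - N i0 := fun i =>
    Int.toNat_of_nonneg (sub_nonneg.2 (hi0 i))
  have hnninj : Function.Injective nn := by
    intro i j hij
    apply hNinj
    have h5 := hnnN i
    rw [hij, hnnN j] at h5
    linarith
  have hpoly : toC (spoly a nn) = ∑ i, C (a i : ℂ) * X ^ (N i - N i0).toNat := by
    simp [spoly, toC, Polynomial.map_sum, hnn]
  have hline : ∀ x : ℝ, Ev A (x • sdir l n) F = ∑ i, (a i : ℂ) *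
      Complex.exp (2 * Real.pi * Complex.I * ((x * (N i : ℤ) : ℝ) : ℂ)) := by
    intro x
    rw [hEv]
    simp only [ech, dot_smul_right, dot_sdir, hN]
  have hnorm : ∀ x : ℝ, ‖Ev A (x • sdir l n) F‖ = ‖(toC (spoly a nn)).eval (cpar x)‖ := by
    intro x
    rw [hline, one_dim_norm _ N (N i0) hi0, hpoly]
  rcases huniv nn hnninj ⟨i0, by simp [hnn]⟩ with hbig | ⟨r, D, m, g, β, hD, hβ, hm, hmB, hg, r1, r2, r3, hs⟩
  · apply hn
    refine ⟨?_, ?_, ?_⟩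
    · have hne : toC (spoly a nn) ≠ 0 := by
        rw [hpoly]
        exact one_dim_ne_zero (fun i => (a i : ℂ)) N (N i0) hi0 hNinj i1 (by exact_mod_cast ha i1)
      filter_upwards [ae_ne_zero _ hne] with x hx
      rw [← norm_ne_zero_iff, hnorm, norm_ne_zero_iff]
      exact hx
    · simp only [hnorm]
      exact integrable_log_cpar _
    · simp only [hnorm]
      rw [integral_log_cpar]
      exact hbig
  · let m' : ι × ι → (Finset.Icc (-(B : ℤ)) B : Finset ℤ) :=
      fun p => ⟨m p, Finset.mem_Icc.2 (abs_le.1 (hmB p))⟩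
    have hm' : (fun p => (m' p : ℤ)) = m := rfl
    set v := vdir e r m with hv
    have hdiff : ∀ i j, (i, j) ∈ r → idir n (A (e j - e i)) = D * m (i, j) := by
      intro i j hij
      have h5 := hm i j hij
      rw [hnnN, hnnN] at h5
      rw [map_sub, idir_sub]
      change N j - N i = _
      linarith
    have hDv : idir n (A v) = D := by
      rw [hv, vdir, map_sum, idir_hom]
      have h5 : ∀ p ∈ r, idir n (A (bez r m p • (e p.2 - e p.1))) = D * (m p * bez r m p) := by
        intro p hp
        rw [map_zsmul, idir_smul, hdiff p.1 p.2 hp]; ring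
      rw [Finset.sum_congr rfl h5, ← Finset.mul_sum, bez_spec r m g hg, mul_one]
    have hAv : A v ≠ 0 := by
      intro h
      rw [h] at hDv
      simp [idir] at hDv
      omega
    have hev : ∀ i j, (i, j) ∈ r → e j - e i = m (i, j) • v := by
      intro i j hij
      by_contra h
      apply hn2 r m' i j (sub_ne_zero.2 h)
      change idir n (A (e j - e i - m (i, j) • v)) = 0
      rw [map_sub, idir_sub, hdiff i j hij, map_zsmul, idir_smul, hDv]
      ring
    have hord : 0 < orderOf β := orderOf_pos_iff.2 (isOfFinOrder_iff_pow_eq_one.2 ⟨Q, hQ, hβ⟩)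
    have hordQ : orderOf β ≤ Q := orderOf_le_of_pow_eq_one hQ hβ
    have hdvd := cyc_dvd a e r m B hmB v β (orderOf β) hord (IsPrimitiveRoot.orderOf β) r1 r2 r3 hev hs
    rw [← hF] at hdvd
    exact hε3 r m' ⟨orderOf β, by omega⟩ hord l A ⟨hAv, hdvd⟩ hmem

theorem main_aux (k : ℕ) : ∀ (Γ : Type) [AddCommGroup Γ] [Module.Finite ℤ Γ] [IsAddTorsionFree Γ],
    Module.finrank ℤ Γ = k → ∀ F : AddMonoidAlgebra ℤ Γ, Good F := by
  classical
  induction k using Nat.strong_induction_on with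
  | _ k ih =>
  intro Γ _ _ _ hk F
  have hfg : AddMonoid.FG Γ :=
    AddGroup.fg_iff_addMonoid_fg.1 (Module.Finite.iff_addGroup_fg.1 inferInstance)
  have hdom : IsDomain (AddMonoidAlgebra ℤ Γ) := inferInstance
  have hnoe : IsNoetherianRing (AddMonoidAlgebra ℤ Γ) := Algebra.FiniteType.isNoetherianRing ℤ _
  have hwf : WfDvdMonoid (AddMonoidAlgebra ℤ Γ) := inferInstance
  induction F using hwf.wf.induction with
  | _ F ihF =>
  by_cases hc : F.coeff.support.card ≤ 1
  · obtain ⟨γ, b, h⟩ := Finsupp.card_support_le_one'.1 hc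
    have : F = AddMonoidAlgebra.single γ b := by
      rw [← AddMonoidAlgebra.sum_coeff_single F, h]
      simp
    rw [this]
    exact Good_single γ b
  push Not at hc
  refine step (ι := F.coeff.support) (fun i => F.coeff i) (fun i => Finsupp.mem_support_iff.1 i.2)
    (by rw [Fintype.card_coe]; exact hc) (fun i => (i : Γ)) Subtype.val_injective F ?_ ?_ ?_
  · conv_lhs => rw [← AddMonoidAlgebra.sum_coeff_single F, Finsupp.sum]
    exact (Finset.sum_coe_sort F.coeff.support (fun γ => AddMonoidAlgebra.single γ (F.coeff γ))).symm
  · intro w hw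
    exact H1 (fun Γ' _ _ _ hlt F' => ih _ (hk ▸ hlt) Γ' rfl F') F w hw
  · intro v d hd
    exact H2 F ihF v d hd

theorem main [Module.Finite ℤ Γ] [IsAddTorsionFree Γ] (F : AddMonoidAlgebra ℤ Γ) : Good F :=
  main_aux _ Γ rfl F
end Main
end ZIso

namespace ZIso

/-- The exponent substitution as an additive homomorphism. -/
def substHom {l k : ℕ} (A : Matrix (Fin l) (Fin k) ℤ) : (Fin k → ℤ) →+ (Fin l → ℤ) where
  toFun := substExp A
  map_zero' := by ext i; simp [substExp]
  map_add' := by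
    intro x y; ext i
    simp [substExp, mul_add, Finset.sum_add_distrib]

lemma prod_torusPt {l : ℕ} (u : Fin l → ℤ) (t : Fin l → ℝ) :
    ∏ i, torusPt t i ^ (u i) = ech u t := by
  unfold ech dot torusPt
  simp only [← Complex.exp_int_mul]
  rw [← Complex.exp_sum]
  congr 1
  push_cast
  rw [Finset.mul_sum]
  refine Finset.sum_congr rfl fun i _ => ?_
  ring

lemma evalT_substM {l k : ℕ} (A : Matrix (Fin l) (Fin k) ℤ) (F : LPoly k)
    (nf : (Fin k → ℤ) → ℤ) (hnf : ∀ e, F e = (nf e : ℂ)) (t : Fin l → ℝ) :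
    evalT (substM A F) (torusPt t)
      = Ev (substHom A) t (∑ e ∈ F.support, AddMonoidAlgebra.single e (nf e)) := by
  have h1 : evalT (substM A F) (torusPt t)
      = (substM A F).sum (fun e c => c * ∏ i, torusPt t i ^ (e i)) := rfl
  rw [h1, substM, Finsupp.sum_mapDomain_index (by simp) (by intros; ring), map_sum, Finsupp.sum]
  refine Finset.sum_congr rfl fun e _ => ?_
  rw [Ev_single, hnf, prod_torusPt]
  rfl

end ZIso


/-- **Theorem 2.** If `F` is a nonzero Laurent polynomial in `k ≥ 1` variables
with integer coefficients and `0 ∈ ℳ(F)`, then `0` is an isolated point of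
`ℳ(F)`. -/
theorem zero_isolated_in_Mset {k : ℕ} (hk : 1 ≤ k) (F : LPoly k) (hF : F ≠ 0)
    (hint : ∀ e, ∃ n : ℤ, F e = (n : ℂ)) (h0 : (0 : ℝ) ∈ Mset F) :
    ∃ ε > 0, Mset F ∩ Set.Ioo 0 ε = ∅ := by
  choose nf hnf using hint
  obtain ⟨ε, hε, h⟩ := ZIso.main (∑ e ∈ F.support, AddMonoidAlgebra.single e (nf e))
  refine ⟨ε, hε, ?_⟩
  rw [Set.eq_empty_iff_forall_notMem]
  rintro x ⟨⟨l, A, -, rfl⟩, hx⟩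
  apply h l (ZIso.substHom A)
  have : mm (substM A F)
      = ZIso.mu (ZIso.substHom A) (∑ e ∈ F.support, AddMonoidAlgebra.single e (nf e)) := by
    unfold mm ZIso.mu
    simp only [ZIso.evalT_substM A F nf hnf]
  rwa [← this]
end
end

section
/- Fix B > 0. The set ℳ_B of logarithmic Mahler measures of all nonzero integer Laurent polynomials (in any number of variables) of length at most B is a closed subset of ℝ, and 0 is an isolated point of ℳ_B. -/
open MeasureTheory

noncomputable section

/-- The set `ℳ_B` of Mahler measures of all nonzero integer Laurent polynomials
(in any number of variables) of length at most `B`. -/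
def MBset (B : ℝ) : Set ℝ :=
  { x | ∃ (k : ℕ) (F : LPoly k), F ≠ 0 ∧ (∀ e, ∃ n : ℤ, F e = (n : ℂ)) ∧
      (∑ e ∈ F.support, ‖F e‖) ≤ B ∧ mm F = x }

open UnitAddTorus

instance uac_prob : IsProbabilityMeasure (volume : Measure UnitAddCircle) :=
  ⟨UnitAddCircle.measure_univ⟩

lemma mF_norm {d : Type} [Fintype d] (n : d → ℤ) (x : UnitAddTorus d) : ‖mFourier n x‖ = 1 := by
  simp only [mFourier, fourier_apply, ContinuousMap.coe_mk, norm_prod, Circle.norm_coe,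
    Finset.prod_const_one]

lemma mF_add_right {d : Type} [Fintype d] (n : d → ℤ) (x y : UnitAddTorus d) :
    mFourier n (x + y) = mFourier n x * mFourier n y := by
  simp [mFourier, fourier_apply, smul_add, AddCircle.toCircle_add, Finset.prod_mul_distrib]

lemma mF_zero_right {d : Type} [Fintype d] (n : d → ℤ) :
    mFourier n (0 : UnitAddTorus d) = 1 := by
  simp [mFourier, fourier_apply]

/-- the homomorphism of tori attached to an exponent vector -/
def expHom {d : Type} [Fintype d] (n : d → ℤ) : UnitAddTorus d →+ UnitAddCircle where
  toFun x := ∑ i, n i • x i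
  map_zero' := by simp
  map_add' x y := by simp [smul_add, Finset.sum_add_distrib]

lemma mF_eq_fourier {d : Type} [Fintype d] (n : d → ℤ) (x : UnitAddTorus d) :
    mFourier n x = fourier 1 (expHom n x) := by
  have h : ∀ s : Finset d, ∏ i ∈ s, fourier (n i) (x i) = fourier 1 (∑ i ∈ s, n i • x i) := by
    classical
    intro s
    induction s using Finset.induction_on with
    | empty => simp [fourier_apply]
    | insert a s ha ih =>
      rw [Finset.prod_insert ha, Finset.sum_insert ha, ih]
      simp [fourier_apply, AddCircle.toCircle_add]
  exact h Finset.univ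

lemma expHom_cont {d : Type} [Fintype d] (n : d → ℤ) : Continuous (expHom n) := by
  change Continuous fun x : UnitAddTorus d => ∑ i, n i • x i
  fun_prop

lemma expHom_mp {d : Type} [Fintype d] (n : d → ℤ) (hn : n ≠ 0) :
    MeasurePreserving (expHom n) volume volume := by
  classical
  apply AddMonoidHom.measurePreserving (expHom_cont n)
  · intro y
    obtain ⟨i, hi⟩ : ∃ i, n i ≠ 0 := by
      by_contra h
      push Not at h
      exact hn (funext h)
    induction y using QuotientAddGroup.induction_on with
    | H a =>
    refine ⟨Pi.single i ((a / n i : ℝ) : UnitAddCircle), ?_⟩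
    change ∑ j, n j • (Pi.single i ((a / n i : ℝ) : UnitAddCircle) : UnitAddTorus d) j = _
    rw [Finset.sum_eq_single i]
    · rw [Pi.single_eq_same, ← AddCircle.coe_zsmul]
      congr 1
      have : (n i : ℝ) ≠ 0 := by exact_mod_cast hi
      rw [zsmul_eq_mul]
      field_simp
    · intro j _ hj
      rw [Pi.single_eq_of_ne hj]; simp
    · simp
  · simp

lemma circle_lower (x : UnitAddCircle) : 4 * ‖x‖ ≤ ‖fourier 1 x - 1‖ := by
  induction x using QuotientAddGroup.induction_on with
  | H a =>
  change 4 * ‖(a : UnitAddCircle)‖ ≤ ‖fourier 1 (a : UnitAddCircle) - 1‖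
  have h1 : (a : UnitAddCircle) = ((a - round a : ℝ) : UnitAddCircle) := by
    rw [AddCircle.coe_sub]
    have : ((round a : ℝ) : UnitAddCircle) = 0 := by
      rw [AddCircle.coe_eq_zero_iff]; exact ⟨round a, by simp⟩
    rw [this, sub_zero]
  rw [UnitAddCircle.norm_eq, h1, fourier_coe_apply]
  set b := a - round a with hb
  have hb2 : |b| ≤ 1 / 2 := abs_sub_round a
  have h2 : (2 * Real.pi * Complex.I * ((1 : ℤ) : ℂ) * (b : ℂ) / ((1 : ℝ) : ℂ)) =
      Complex.I * ((2 * Real.pi * b : ℝ) : ℂ) := by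
    push_cast; ring
  rw [h2, Complex.norm_exp_I_mul_ofReal_sub_one]
  have h3 : 2 * Real.pi * b / 2 = Real.pi * b := by ring
  have hpi := Real.pi_pos
  have h4 : |Real.pi * b| ≤ Real.pi / 2 := by
    rw [abs_mul, abs_of_pos hpi]; nlinarith
  have h5 := Real.mul_abs_le_abs_sin h4
  rw [h3, norm_mul, Real.norm_eq_abs, Real.norm_eq_abs, abs_two]
  rw [abs_mul, abs_of_pos hpi, ← mul_assoc, div_mul_cancel₀ _ hpi.ne'] at h5
  linarith

lemma char_small {d : Type} [Fintype d] (n : d → ℤ) (hn : n ≠ 0) (r : ℝ) (hr : 0 ≤ r) :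
    (volume : Measure (UnitAddTorus d)).real {x | ‖mFourier n x - 1‖ < r} ≤ r := by
  have h1 : {x : UnitAddTorus d | ‖mFourier n x - 1‖ < r} ⊆
      expHom n ⁻¹' (Metric.closedBall 0 (r / 4)) := by
    intro x hx
    simp only [Set.mem_ofPred_eq, mF_eq_fourier] at hx
    have := circle_lower (expHom n x)
    simp only [Set.mem_preimage, mem_closedBall_zero_iff]
    linarith
  calc _ ≤ (volume : Measure (UnitAddTorus d)).real (expHom n ⁻¹' (Metric.closedBall 0 (r / 4))) :=
        measureReal_mono h1
    _ = (volume : Measure UnitAddCircle).real (Metric.closedBall 0 (r / 4)) := by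
        unfold Measure.real
        rw [(expHom_mp n hn).measure_preimage measurableSet_closedBall.nullMeasurableSet]
    _ ≤ r := by
        unfold Measure.real
        rw [AddCircle.volume_closedBall]
        apply ENNReal.toReal_le_of_le_ofReal hr
        apply ENNReal.ofReal_le_ofReal
        exact (min_le_right _ _).trans (by linarith)

lemma mF_integral {d : Type} [Fintype d] (n : d → ℤ) :
    ∫ x : UnitAddTorus d, mFourier n x = if n = 0 then 1 else 0 := by
  split_ifs with h
  · subst h; simp [mFourier_zero]
  · obtain ⟨w, hw⟩ : ∃ w : UnitAddTorus d, mFourier n w ≠ 1 := by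
      by_contra hcon
      push Not at hcon
      have := char_small n h (1 / 2) (by norm_num)
      have h2 : {x : UnitAddTorus d | ‖mFourier n x - 1‖ < 1 / 2} = Set.univ := by
        ext x; simp [hcon x]
      rw [h2] at this
      simp at this
      norm_num at this
    have h1 : ∫ x : UnitAddTorus d, mFourier n (w + x) = ∫ x : UnitAddTorus d, mFourier n x :=
      integral_add_left_eq_self (fun x => mFourier n x) w
    simp only [mF_add_right] at h1
    rw [integral_const_mul] at h1
    have h2 : (mFourier n w - 1) * ∫ x : UnitAddTorus d, mFourier n x = 0 := by
      rw [sub_mul, h1]; ring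
    rcases mul_eq_zero.mp h2 with h3 | h3
    · exact absurd (sub_eq_zero.mp h3) hw
    · exact h3

/-- exponential polynomial on a torus -/
def pol {d ι : Type} [Fintype d] (s : Finset ι) (c : ι → ℂ) (e : ι → d → ℤ)
    (x : UnitAddTorus d) : ℂ := ∑ j ∈ s, c j * mFourier (e j) x

lemma pol_cont {d ι : Type} [Fintype d] (s : Finset ι) (c : ι → ℂ) (e : ι → d → ℤ) :
    Continuous (pol s c e) := by
  unfold pol
  fun_prop

lemma tail_step_sq {d : Type} [Fintype d] (S : Set (UnitAddTorus d)) (hS : MeasurableSet S)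
    (W : Set (UnitAddTorus d)) (a K : ℝ) (ha : 0 ≤ a) (hK : 0 ≤ K)
    (hW : (volume : Measure (UnitAddTorus d)).real W ≤ a) (hWm : MeasurableSet W)
    (h : ∀ w, w ∉ W → (volume : Measure (UnitAddTorus d)).real {x | x ∈ S ∧ w + x ∈ S} ≤ K) :
    (volume : Measure (UnitAddTorus d)).real S ^ 2 ≤ a + K := by
  set μ := (volume : Measure (UnitAddTorus d)) with hμ
  have hm : MeasurableSet {q : UnitAddTorus d × UnitAddTorus d | q.2 ∈ S ∧ q.1 + q.2 ∈ S} :=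
    (measurable_snd hS).inter ((measurable_fst.add measurable_snd) hS)
  have h1 := Measure.prod_apply (μ := μ) (ν := μ) hm
  have h2 := Measure.prod_apply_symm (μ := μ) (ν := μ) hm
  have h3 : ∫⁻ y, μ ((fun x => (x, y)) ⁻¹' {q : UnitAddTorus d × UnitAddTorus d |
      q.2 ∈ S ∧ q.1 + q.2 ∈ S}) ∂μ = μ S * μ S := by
    have : ∀ y, μ ((fun x => (x, y)) ⁻¹' {q : UnitAddTorus d × UnitAddTorus d |
      q.2 ∈ S ∧ q.1 + q.2 ∈ S}) = S.indicator (fun _ => μ S) y := by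
      intro y
      by_cases hy : y ∈ S
      · rw [Set.indicator_of_mem hy]
        have : ((fun x => (x, y)) ⁻¹' {q : UnitAddTorus d × UnitAddTorus d |
          q.2 ∈ S ∧ q.1 + q.2 ∈ S}) = (fun x => x + y) ⁻¹' S := by
          ext x; simp [hy]
        rw [this, measure_preimage_add_right]
      · rw [Set.indicator_of_notMem hy]
        have : ((fun x => (x, y)) ⁻¹' {q : UnitAddTorus d × UnitAddTorus d |
          q.2 ∈ S ∧ q.1 + q.2 ∈ S}) = ∅ := by
          ext x; simp [hy]
        rw [this, measure_empty]
    simp_rw [this]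
    rw [lintegral_indicator hS, lintegral_const, Measure.restrict_apply_univ]
  have h4 : ∫⁻ w, μ (Prod.mk w ⁻¹' {q : UnitAddTorus d × UnitAddTorus d |
      q.2 ∈ S ∧ q.1 + q.2 ∈ S}) ∂μ ≤ ENNReal.ofReal (a + K) := by
    calc _ ≤ ∫⁻ w, (W.indicator (fun _ => 1) w + ENNReal.ofReal K) ∂μ := by
          apply lintegral_mono
          intro w
          by_cases hw : w ∈ W
          · simp only [Set.indicator_of_mem hw]
            exact prob_le_one.trans le_self_add
          · simp only [Set.indicator_of_notMem hw, zero_add]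
            rw [← ofReal_measureReal]
            exact ENNReal.ofReal_le_ofReal (h w hw)
      _ = μ W + ENNReal.ofReal K := by
          rw [lintegral_add_right _ measurable_const, lintegral_indicator hWm]
          simp
      _ ≤ _ := by
          rw [ENNReal.ofReal_add ha hK]
          gcongr
          rw [← ofReal_measureReal]
          exact ENNReal.ofReal_le_ofReal hW
  rw [h1, h3] at h2
  rw [h2] at h4
  have h5 := ENNReal.toReal_le_of_le_ofReal (by positivity) h4
  rw [ENNReal.toReal_mul] at h5
  rw [sq]; exact h5

lemma tail (n : ℕ) : ∃ C δ : ℝ, 1 ≤ C ∧ 0 < δ ∧ δ ≤ 1 ∧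
    ∀ (d ι : Type) [Fintype d] (s : Finset ι) (c : ι → ℂ) (e : ι → d → ℤ),
      s.card = n + 1 → Set.InjOn e s → ∀ η > 0, (∀ j ∈ s, η ≤ ‖c j‖) → ∀ ε > 0,
      (volume : Measure (UnitAddTorus d)).real {x | ‖pol s c e x‖ < ε * η} ≤ C * ε ^ δ := by
  classical
  induction n with
  | zero =>
    refine ⟨1, 1, le_rfl, one_pos, le_rfl, ?_⟩
    intro d ι _ s c e hs _ η hη hc ε hε
    obtain ⟨j, rfl⟩ := Finset.card_eq_one.mp hs
    have hj := hc j (by simp)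
    rw [Real.rpow_one, one_mul]
    by_cases h : ε ≤ 1
    · have : {x | ‖pol {j} c e x‖ < ε * η} = ∅ := by
        ext x
        simp only [pol, Finset.sum_singleton, norm_mul, mF_norm, mul_one, Set.mem_ofPred_eq,
          Set.mem_empty_iff_false, iff_false, not_lt]
        nlinarith
      rw [this]; simp [hε.le]
    · exact measureReal_le_one.trans (not_le.mp h).le
  | succ n ih =>
    obtain ⟨C, δ, hC, hδ, hδ1, ih⟩ := ih
    refine ⟨n + 1 + 2 * C, δ / 4, by nlinarith [n.cast_nonneg (α := ℝ)], by positivity,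
      by linarith, ?_⟩
    intro d ι _ s c e hs he η hη hc ε hε
    have hn0 := n.cast_nonneg (α := ℝ)
    by_cases hε1 : 1 < ε
    · refine measureReal_le_one.trans ?_
      have := Real.one_le_rpow hε1.le (by positivity : 0 ≤ δ / 4)
      nlinarith
    push Not at hε1
    obtain ⟨j0, s', hj0, rfl, hs'⟩ := Finset.card_eq_succ.mp hs
    set r := √ε with hr
    have hr0 : 0 < r := Real.sqrt_pos.mpr hε
    have hrr : r * r = ε := Real.mul_self_sqrt hε.le
    have hS : MeasurableSet {x | ‖pol (insert j0 s') c e x‖ < ε * η} :=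
      (isOpen_lt (pol_cont _ _ _).norm continuous_const).measurableSet
    have key := tail_step_sq _ hS
      (⋃ j ∈ s', {w : UnitAddTorus d | ‖mFourier (e j - e j0) w - 1‖ < r})
      ((n + 1) * r) (C * (2 * r) ^ δ) (by positivity) (by positivity) ?_ ?_ ?_
    · have e1 : r = ε ^ (1 / 2 : ℝ) := Real.sqrt_eq_rpow ε
      have h1 : r ≤ ε ^ (δ / 2) := by
        rw [e1]
        exact Real.rpow_le_rpow_of_exponent_ge hε hε1 (by linarith)
      have h2 : (2 * r) ^ δ ≤ 2 * ε ^ (δ / 2) := by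
        rw [Real.mul_rpow (by norm_num) hr0.le, e1, ← Real.rpow_mul hε.le]
        have h3 : (2 : ℝ) ^ δ ≤ 2 := by
          calc (2 : ℝ) ^ δ ≤ 2 ^ (1 : ℝ) := Real.rpow_le_rpow_of_exponent_le (by norm_num) hδ1
            _ = 2 := Real.rpow_one 2
        have h4 : 1 / 2 * δ = δ / 2 := by ring
        rw [h4]
        gcongr
      have h5 : (ε ^ (δ / 4)) ^ 2 = ε ^ (δ / 2) := by
        rw [← Real.rpow_natCast, ← Real.rpow_mul hε.le]
        congr 1; push_cast; ring
      have h6 : 0 < ε ^ (δ / 2) := Real.rpow_pos_of_pos hε _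
      have h7 : 0 < ε ^ (δ / 4) := Real.rpow_pos_of_pos hε _
      refine (sq_le_sq₀ measureReal_nonneg (by positivity)).mp ?_
      calc _ ≤ _ := key
        _ ≤ (n + 1) * ε ^ (δ / 2) + C * (2 * ε ^ (δ / 2)) := by gcongr
        _ = (n + 1 + 2 * C) * ε ^ (δ / 2) := by ring
        _ ≤ (n + 1 + 2 * C) ^ 2 * ε ^ (δ / 2) := by
            gcongr
            nlinarith
        _ = _ := by rw [mul_pow, h5]
    · calc _ ≤ ∑ j ∈ s', (volume : Measure (UnitAddTorus d)).real
              {w : UnitAddTorus d | ‖mFourier (e j - e j0) w - 1‖ < r} :=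
            measureReal_biUnion_finset_le _ _
        _ ≤ ∑ j ∈ s', r := by
            apply Finset.sum_le_sum
            intro j hj
            apply char_small _ _ _ hr0.le
            intro h0
            have := he (Finset.mem_coe.mpr (Finset.mem_insert_of_mem hj))
              (Finset.mem_coe.mpr (Finset.mem_insert_self _ _)) (sub_eq_zero.mp h0)
            exact hj0 (this ▸ hj)
        _ = (n + 1) * r := by simp [hs']
    · apply Finset.measurableSet_biUnion
      intro j _
      exact (isOpen_lt (by fun_prop) continuous_const).measurableSet
    · intro w hw
      simp only [Set.mem_iUnion, Set.mem_ofPred_eq, not_exists, not_lt] at hw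
      have := ih d ι s' (fun j => c j * (mFourier (e j - e j0) w - 1)) e hs'
        (he.mono (by simp)) (η * r) (by positivity) (by
          intro j hj
          rw [norm_mul]
          have h1 := hw j hj
          have h2 := hc j (Finset.mem_insert_of_mem hj)
          gcongr) (2 * r) (by positivity)
      refine le_trans (measureReal_mono ?_) this
      rintro x ⟨hx1, hx2⟩
      simp only [Set.mem_ofPred_eq] at hx1 hx2 ⊢
      have hid : pol s' (fun j => c j * (mFourier (e j - e j0) w - 1)) e x =
          mFourier (-e j0) w * pol (insert j0 s') c e (w + x) - pol (insert j0 s') c e x := by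
        unfold pol
        rw [Finset.sum_insert hj0, Finset.sum_insert hj0, mul_add, Finset.mul_sum]
        have h0 : mFourier (-e j0) w * (c j0 * mFourier (e j0) (w + x)) =
            c j0 * mFourier (e j0) x := by
          rw [mF_add_right]
          have : mFourier (-e j0) w * mFourier (e j0) w = 1 := by
            rw [← mFourier_add]; simp [mFourier_zero]
          linear_combination (c j0 * mFourier (e j0) x) * this
        rw [h0, add_sub_add_left_eq_sub, ← Finset.sum_sub_distrib]
        apply Finset.sum_congr rfl
        intro j _
        beta_reduce
        rw [mF_add_right, sub_eq_add_neg (e j), mFourier_add]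
        ring
      rw [hid]
      calc _ ≤ ‖mFourier (-e j0) w * pol (insert j0 s') c e (w + x)‖ +
            ‖pol (insert j0 s') c e x‖ := norm_sub_le _ _
        _ < ε * η + ε * η := by
            rw [norm_mul, mF_norm, one_mul]; linarith
        _ = _ := by rw [← hrr]; ring

/-- truncated logarithm of the absolute value of an exponential polynomial -/
def tlog {d ι : Type} [Fintype d] (s : Finset ι) (c : ι → ℂ) (e : ι → d → ℤ) (ε : ℝ)
    (x : UnitAddTorus d) : ℝ := Real.log (max ‖pol s c e x‖ ε)

/-- the Mahler measure of an exponential polynomial -/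
def lm {d ι : Type} [Fintype d] (s : Finset ι) (c : ι → ℂ) (e : ι → d → ℤ) : ℝ :=
  ∫ x : UnitAddTorus d, Real.log ‖pol s c e x‖

lemma tlog_cont {d ι : Type} [Fintype d] (s : Finset ι) (c : ι → ℂ) (e : ι → d → ℤ) (ε : ℝ)
    (hε : 0 < ε) : Continuous (tlog s c e ε) := by
  unfold tlog
  refine Continuous.log ((pol_cont _ _ _).norm.max continuous_const) ?_
  intro x
  exact (lt_max_of_lt_right hε).ne'

lemma tlog_int {d ι : Type} [Fintype d] (s : Finset ι) (c : ι → ℂ) (e : ι → d → ℤ) (ε : ℝ)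
    (hε : 0 < ε) : Integrable (tlog s c e ε) :=
  (tlog_cont s c e ε hε).integrable_of_hasCompactSupport (HasCompactSupport.of_compactSpace _)

lemma count_bound (h ε : ℝ) (hh : 0 ≤ h) (hε : 0 < ε) :
    ‖Real.log (max h ε) - Real.log h‖ₑ ≤
      ∑' n : ℕ, (if h < ε * Real.exp (-n) then (1 : ENNReal) else 0) := by
  rcases hh.eq_or_lt with rfl | hpos
  · have : ∀ n : ℕ, (0 : ℝ) < ε * Real.exp (-n) := fun n => by positivity
    simp only [this, if_true]
    rw [ENNReal.tsum_const_eq_top_of_ne_zero one_ne_zero]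
    exact le_top
  · by_cases hle : ε ≤ h
    · rw [max_eq_left hle]; simp
    · push Not at hle
      rw [max_eq_right hle.le]
      set y := Real.log ε - Real.log h with hy
      have hy0 : 0 < y := sub_pos.mpr (Real.log_lt_log hpos hle)
      calc ‖y‖ₑ = ENNReal.ofReal y := by rw [Real.enorm_eq_ofReal hy0.le]
        _ ≤ ENNReal.ofReal (⌈y⌉₊ : ℝ) := ENNReal.ofReal_le_ofReal (Nat.le_ceil y)
        _ = ∑ n ∈ Finset.range ⌈y⌉₊, (1 : ENNReal) := by simp
        _ = ∑ n ∈ Finset.range ⌈y⌉₊, (if h < ε * Real.exp (-n) then (1 : ENNReal) else 0) := by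
            apply Finset.sum_congr rfl
            intro n hn
            rw [Finset.mem_range, Nat.lt_ceil] at hn
            rw [if_pos]
            rw [← Real.log_lt_log_iff hpos (by positivity), Real.log_mul hε.ne'
              (Real.exp_pos _).ne', Real.log_exp]
            linarith
        _ ≤ _ := ENNReal.sum_le_tsum _

lemma unif (n : ℕ) (η : ℝ) (hη : 0 < η) : ∃ ε > 0,
    ∀ (d ι : Type) [Fintype d] (s : Finset ι) (c : ι → ℂ) (e : ι → d → ℤ),
      s.card = n + 1 → Set.InjOn e s → (∀ j ∈ s, 1 ≤ ‖c j‖) →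
      Integrable (fun x : UnitAddTorus d => Real.log ‖pol s c e x‖) ∧
      |lm s c e - ∫ x, tlog s c e ε x| ≤ η := by
  obtain ⟨C, δ, hC, hδ, hδ1, H⟩ := tail n
  set q := Real.exp (-δ) with hq
  have hq1 : q < 1 := by rw [hq, Real.exp_lt_one_iff]; linarith
  have hq0 : 0 < q := Real.exp_pos _
  have hC0 : 0 < C := by linarith
  have hq2 : 0 < 1 - q := by linarith
  set a := η * (1 - q) / C with ha
  have ha0 : 0 < a := by positivity
  refine ⟨a ^ (1 / δ), by positivity, ?_⟩
  set ε := a ^ (1 / δ) with hεd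
  have hε : 0 < ε := by positivity
  have hεδ : ε ^ δ = a := by
    rw [hεd, ← Real.rpow_mul ha0.le, one_div_mul_cancel hδ.ne', Real.rpow_one]
  intro d ι _ s c e hs he hc
  have hm : Measurable fun x : UnitAddTorus d => Real.log ‖pol s c e x‖ :=
    Real.measurable_log.comp (pol_cont s c e).norm.measurable
  have hms : ∀ n : ℕ, MeasurableSet {x : UnitAddTorus d | ‖pol s c e x‖ < ε * Real.exp (-n)} :=
    fun n => (isOpen_lt (pol_cont _ _ _).norm continuous_const).measurableSet
  have hb : ∫⁻ x : UnitAddTorus d, ‖tlog s c e ε x - Real.log ‖pol s c e x‖‖ₑ ≤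
      ENNReal.ofReal η := by
    calc _ ≤ ∫⁻ x : UnitAddTorus d, ∑' n : ℕ,
          (if ‖pol s c e x‖ < ε * Real.exp (-n) then (1 : ENNReal) else 0) :=
          lintegral_mono fun x => count_bound _ _ (norm_nonneg _) hε
      _ = ∑' n : ℕ, ∫⁻ x : UnitAddTorus d,
          (if ‖pol s c e x‖ < ε * Real.exp (-n) then (1 : ENNReal) else 0) := by
          apply lintegral_tsum
          intro n
          exact (Measurable.ite (hms n) measurable_const measurable_const).aemeasurable
      _ = ∑' n : ℕ, volume {x : UnitAddTorus d | ‖pol s c e x‖ < ε * Real.exp (-n)} := by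
          congr 1
          ext n
          rw [← lintegral_indicator_one (hms n)]
          rfl
      _ ≤ ∑' n : ℕ, ENNReal.ofReal (C * a * q ^ n) := by
          apply ENNReal.tsum_le_tsum
          intro n
          rw [← ofReal_measureReal]
          apply ENNReal.ofReal_le_ofReal
          have := H d ι s c e hs he 1 one_pos hc (ε * Real.exp (-n)) (by positivity)
          rw [mul_one] at this
          refine this.trans (le_of_eq ?_)
          rw [Real.mul_rpow hε.le (Real.exp_pos _).le, hεδ, ← Real.exp_mul, hq, ← Real.exp_nat_mul,
            ← mul_assoc]
          congr 2
          ring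
      _ = ENNReal.ofReal (∑' n : ℕ, C * a * q ^ n) := by
          rw [ENNReal.ofReal_tsum_of_nonneg]
          · intro n; positivity
          · exact (summable_geometric_of_lt_one hq0.le hq1).mul_left _
      _ = ENNReal.ofReal η := by
          congr 1
          rw [tsum_mul_left, tsum_geometric_of_lt_one hq0.le hq1, ha]
          field_simp
  have hdiff : Integrable (fun x : UnitAddTorus d => tlog s c e ε x - Real.log ‖pol s c e x‖) :=
    ⟨((tlog_cont s c e ε hε).measurable.sub hm).aestronglyMeasurable,
      lt_of_le_of_lt hb ENNReal.ofReal_lt_top⟩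
  have hi : Integrable (fun x : UnitAddTorus d => Real.log ‖pol s c e x‖) := by
    have := (tlog_int s c e ε hε).sub hdiff
    refine this.congr (Filter.Eventually.of_forall fun x => ?_)
    simp
  refine ⟨hi, ?_⟩
  have h1 := (enorm_integral_le_lintegral_enorm
    (fun x : UnitAddTorus d => tlog s c e ε x - Real.log ‖pol s c e x‖)).trans hb
  rw [integral_sub (tlog_int s c e ε hε) hi] at h1
  rw [abs_sub_comm]
  rw [← ofReal_norm, ENNReal.ofReal_le_ofReal_iff hη.le] at h1
  exact h1

lemma lm_int {d ι : Type} [Fintype d] (s : Finset ι) (c : ι → ℂ) (e : ι → d → ℤ)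
    (hs : s.Nonempty) (he : Set.InjOn e s) (hc : ∀ j ∈ s, 1 ≤ ‖c j‖) :
    Integrable (fun x : UnitAddTorus d => Real.log ‖pol s c e x‖) := by
  obtain ⟨n, hn⟩ : ∃ n, s.card = n + 1 :=
    Nat.exists_eq_succ_of_ne_zero (Finset.card_pos.mpr hs).ne'
  obtain ⟨ε, -, h⟩ := unif n 1 one_pos
  exact (h d ι s c e hn he hc).1

open Filter Topology

/-- the homomorphism of tori attached to a family of exponent vectors -/
def Phi {d ι : Type} [Fintype d] (e : ι → d → ℤ) (x : UnitAddTorus d) : UnitAddTorus ι :=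
  fun j => expHom (e j) x

lemma Phi_cont {d ι : Type} [Fintype d] (e : ι → d → ℤ) : Continuous (Phi e) :=
  continuous_pi fun j => expHom_cont (e j)

lemma mF_Phi {d ι : Type} [Fintype d] [Fintype ι] (e : ι → d → ℤ) (v : ι → ℤ)
    (x : UnitAddTorus d) : mFourier v (Phi e x) = mFourier (∑ j, v j • e j) x := by
  rw [mF_eq_fourier, mF_eq_fourier]
  congr 1
  change ∑ j, v j • ∑ i, e j i • x i = ∑ i, (∑ j, v j • e j) i • x i
  simp only [Finset.smul_sum, Finset.sum_apply, Finset.sum_smul, Pi.smul_apply, smul_eq_mul,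
    mul_smul]
  rw [Finset.sum_comm]

lemma cont_int {d : Type} [Fintype d] (f : UnitAddTorus d → ℂ) (hf : Continuous f) :
    Integrable f := hf.integrable_of_hasCompactSupport (HasCompactSupport.of_compactSpace _)

lemma Phi_int {d ι : Type} [Fintype d] [Fintype ι] (e : ι → d → ℤ)
    (g : C(UnitAddTorus ι, ℂ)) : Integrable fun x => g (Phi e x) :=
  cont_int _ (g.continuous.comp (Phi_cont e))

lemma Phi_bound {d ι : Type} [Fintype d] [Fintype ι] (e : ι → d → ℤ)
    (g g' : C(UnitAddTorus ι, ℂ)) :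
    ‖(∫ x, g (Phi e x)) - ∫ x, g' (Phi e x)‖ ≤ ‖g - g'‖ := by
  rw [← integral_sub (Phi_int e g)
    (Phi_int e g')]
  have := norm_integral_le_of_norm_le_const (μ := (volume : Measure (UnitAddTorus d)))
    (f := fun x => g (Phi e x) - g' (Phi e x)) (C := ‖g - g'‖)
    (Eventually.of_forall fun x => (g - g').norm_coe_le_norm (Phi e x))
  simpa using this

lemma weak {ι Y : Type} [Fintype ι] (u : Filter Y) (d : Y → Type) [∀ y, Fintype (d y)]
    (e : ∀ y, ι → d y → ℤ) (d' : Type) [Fintype d'] (e' : ι → d' → ℤ)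
    (h : ∀ v : ι → ℤ, ∀ᶠ y in u, (∑ j, v j • e y j = 0 ↔ ∑ j, v j • e' j = 0))
    (g : C(UnitAddTorus ι, ℂ)) :
    Tendsto (fun y => ∫ x, g (Phi (e y) x)) u (𝓝 (∫ x, g (Phi e' x))) := by
  have hspan : ∀ g ∈ Submodule.span ℂ (Set.range (mFourier (d := ι))),
      Tendsto (fun y => ∫ x, g (Phi (e y) x)) u (𝓝 (∫ x, g (Phi e' x))) := by
    intro g hg
    induction hg using Submodule.span_induction with
    | mem g hg =>
      obtain ⟨v, rfl⟩ := hg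
      apply tendsto_const_nhds.congr'
      filter_upwards [h v] with y hy
      simp only [mF_Phi, mF_integral, hy]
    | zero => simpa using tendsto_const_nhds
    | add g g' _ _ h1 h2 =>
      simp only [ContinuousMap.add_apply]
      rw [integral_add (Phi_int e' g)
        (Phi_int e' g')]
      refine (h1.add h2).congr fun y => ?_
      rw [integral_add (Phi_int (e y) g)
        (Phi_int (e y) g')]
    | smul a g _ h1 =>
      simp only [ContinuousMap.smul_apply, integral_smul]
      exact h1.const_smul a
  rw [Metric.tendsto_nhds]
  intro η hη
  have hg : g ∈ (Submodule.span ℂ (Set.range (mFourier (d := ι)))).topologicalClosure := by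
    rw [span_mFourier_closure_eq_top]; trivial
  obtain ⟨g', hg', hgg⟩ := Metric.mem_closure_iff.mp
    (show g ∈ closure (Submodule.span ℂ (Set.range (mFourier (d := ι))) : Set _) from hg)
    (η / 3) (by positivity)
  filter_upwards [Metric.tendsto_nhds.mp (hspan g' hg') (η / 3) (by positivity)] with y hy
  have h1 := Phi_bound (e y) g g'
  have h2 := Phi_bound e' g g'
  rw [← dist_eq_norm, ← dist_eq_norm] at h1 h2
  have h3 := dist_triangle4 (∫ x, g (Phi (e y) x)) (∫ x, g' (Phi (e y) x))
    (∫ x, g' (Phi e' x)) (∫ x, g (Phi e' x))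
  rw [dist_comm (∫ x, g' (Phi e' x))] at h3
  linarith

lemma tlog_tendsto {ι Y : Type} [Fintype ι] (u : Filter Y) (d : Y → Type) [∀ y, Fintype (d y)]
    (e : ∀ y, ι → d y → ℤ) (d' : Type) [Fintype d'] (e' : ι → d' → ℤ)
    (h : ∀ v : ι → ℤ, ∀ᶠ y in u, (∑ j, v j • e y j = 0 ↔ ∑ j, v j • e' j = 0))
    (c : ι → ℂ) (ε : ℝ) (hε : 0 < ε) :
    Tendsto (fun y => ∫ x, tlog Finset.univ c (e y) ε x) u
      (𝓝 (∫ x, tlog Finset.univ c e' ε x)) := by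
  classical
  have hc := tlog_cont Finset.univ c (fun j : ι => (Pi.single j 1 : ι → ℤ)) ε hε
  have hw := weak u d e d' e' h
    ⟨fun w => ((tlog Finset.univ c (fun j : ι => (Pi.single j 1 : ι → ℤ)) ε w : ℝ) : ℂ),
      Complex.continuous_ofReal.comp hc⟩
  have key : ∀ (d : Type) [Fintype d] (e : ι → d → ℤ) (x : UnitAddTorus d),
      tlog Finset.univ c (fun j : ι => (Pi.single j 1 : ι → ℤ)) ε (Phi e x) =
      tlog Finset.univ c e ε x := by
    intro d _ e x
    unfold tlog pol
    congr 3
    apply Finset.sum_congr rfl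
    intro j _
    rw [mFourier_single, mF_eq_fourier]
    rfl
  simp only [ContinuousMap.coe_mk, key, integral_complex_ofReal] at hw
  exact_mod_cast (Complex.continuous_re.tendsto _).comp hw

lemma lm_tendsto {ι Y : Type} [Fintype ι] [Nonempty ι] (u : Filter Y) (d : Y → Type)
    [∀ y, Fintype (d y)]
    (e : ∀ y, ι → d y → ℤ) (d' : Type) [Fintype d'] (e' : ι → d' → ℤ)
    (h : ∀ v : ι → ℤ, ∀ᶠ y in u, (∑ j, v j • e y j = 0 ↔ ∑ j, v j • e' j = 0))
    (c : ι → ℂ) (hc : ∀ j, 1 ≤ ‖c j‖) (he : ∀ᶠ y in u, Function.Injective (e y))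
    (he' : Function.Injective e') :
    Tendsto (fun y => lm Finset.univ c (e y)) u (𝓝 (lm Finset.univ c e')) := by
  obtain ⟨n, hn⟩ : ∃ n, (Finset.univ : Finset ι).card = n + 1 :=
    Nat.exists_eq_succ_of_ne_zero (Finset.card_pos.mpr Finset.univ_nonempty).ne'
  rw [Metric.tendsto_nhds]
  intro η hη
  obtain ⟨ε, hε, H⟩ := unif n (η / 3) (by positivity)
  filter_upwards [Metric.tendsto_nhds.mp (tlog_tendsto u d e d' e' h c ε hε) (η / 3)
    (by positivity), he] with y hy hey
  have h1 := (H _ _ Finset.univ c (e y) hn hey.injOn (fun j _ => hc j)).2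
  have h2 := (H _ _ Finset.univ c e' hn he'.injOn (fun j _ => hc j)).2
  rw [← Real.dist_eq] at h1 h2
  have h3 := dist_triangle4 (lm Finset.univ c (e y)) (∫ x, tlog Finset.univ c (e y) ε x)
    (∫ x, tlog Finset.univ c e' ε x) (lm Finset.univ c e')
  rw [dist_comm (∫ x, tlog Finset.univ c e' ε x) (lm Finset.univ c e')] at h3
  linarith

/-- The measure only depends on the relations between the exponents. -/
lemma lm_eq {ι : Type} [Fintype ι] [Nonempty ι] (d d' : Type) [Fintype d] [Fintype d']
    (e : ι → d → ℤ) (e' : ι → d' → ℤ)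
    (h : ∀ v : ι → ℤ, (∑ j, v j • e j = 0 ↔ ∑ j, v j • e' j = 0))
    (c : ι → ℂ) (hc : ∀ j, 1 ≤ ‖c j‖) (he : Function.Injective e)
    (he' : Function.Injective e') : lm Finset.univ c e = lm Finset.univ c e' :=
  tendsto_nhds_unique tendsto_const_nhds
    (lm_tendsto (⊤ : Filter Unit) (fun _ => d) (fun _ => e) d' e'
      (fun v => Eventually.of_forall fun _ => h v) c hc (Eventually.of_forall fun _ => he) he')

/-- twisted coefficients -/
def tw {d ι : Type} [Fintype d] (c : ι → ℂ) (e : ι → d → ℤ) (z : UnitAddTorus d) : ι → ℂ :=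
  fun j => c j * mFourier (e j) z

lemma tw_norm {d ι : Type} [Fintype d] (c : ι → ℂ) (e : ι → d → ℤ) (z : UnitAddTorus d) (j : ι) :
    ‖tw c e z j‖ = ‖c j‖ := by
  simp [tw, mF_norm]

lemma lm_prod {ι : Type} [Fintype ι] [Nonempty ι] (d d' : Type) [Fintype d] [Fintype d']
    (e : ι → d → ℤ) (f : ι → d' → ℤ)
    (h : ∀ v : ι → ℤ, ∑ j, v j • e j = 0 → ∑ j, v j • f j = 0)
    (c : ι → ℂ) (hc : ∀ j, 1 ≤ ‖c j‖) (he : Function.Injective e) :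
    lm Finset.univ c e = ∫ z, lm Finset.univ (tw c e z) f := by
  set E : ι → (d ⊕ d') → ℤ := fun j => Sum.elim (e j) (f j) with hE
  have hEinj : Function.Injective E := by
    intro i j hij
    apply he
    funext a
    exact congrFun hij (Sum.inl a)
  have h0 : lm Finset.univ c e = lm Finset.univ c E := by
    apply lm_eq _ _ _ _ _ c hc he hEinj
    intro v
    have hv : ∑ j, v j • E j = Sum.elim (∑ j, v j • e j) (∑ j, v j • f j) := by
      funext a
      cases a <;> simp [hE, Finset.sum_apply]
    rw [hv]
    constructor
    · intro h1
      rw [h1, h v h1]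
      funext a; cases a <;> rfl
    · intro h1
      funext a
      exact congrFun h1 (Sum.inl a)
  rw [h0]
  have hi := lm_int Finset.univ c E Finset.univ_nonempty hEinj.injOn (fun j _ => hc j)
  have mp := (volume_measurePreserving_sumPiEquivProdPi (fun _ : d ⊕ d' => UnitAddCircle)).symm
  have hval : ∀ z : UnitAddTorus d, ∀ w : UnitAddTorus d',
      pol Finset.univ c E ((MeasurableEquiv.sumPiEquivProdPi (fun _ : d ⊕ d' => UnitAddCircle)).symm
        (z, w)) = pol Finset.univ (tw c e z) f w := by
    intro z w
    unfold pol tw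
    apply Finset.sum_congr rfl
    intro j _
    rw [mul_assoc]
    congr 1
    change ∏ i, fourier (E j i) _ = (∏ i, fourier (e j i) (z i)) * ∏ i, fourier (f j i) (w i)
    rw [Fintype.prod_sum_type]
    rfl
  unfold lm
  have hi2 := mp.integrable_comp_of_integrable hi
  rw [← mp.integral_comp (MeasurableEquiv.measurableEmbedding _)]
  have hi3 : Integrable (fun q : UnitAddTorus d × UnitAddTorus d' =>
      Real.log ‖pol Finset.univ c E
        ((MeasurableEquiv.sumPiEquivProdPi (fun _ : d ⊕ d' => UnitAddCircle)).symm q)‖)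
      ((volume : Measure (UnitAddTorus d)).prod (volume : Measure (UnitAddTorus d'))) := hi2
  change ∫ q, Real.log ‖pol Finset.univ c E
        ((MeasurableEquiv.sumPiEquivProdPi (fun _ : d ⊕ d' => UnitAddCircle)).symm q)‖
      ∂((volume : Measure (UnitAddTorus d)).prod (volume : Measure (UnitAddTorus d'))) = _
  rw [integral_prod _ hi3]
  simp only [hval]

lemma circle_int_eq (p : Polynomial ℂ) :
    ∫ x : UnitAddCircle, Real.log ‖p.eval (fourier 1 x)‖ = p.logMahlerMeasure := by
  rw [← UnitAddCircle.intervalIntegral_preimage 0, Polynomial.logMahlerMeasure_def,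
    Real.circleAverage_def]
  have h1 : ∀ a : ℝ, (fourier 1 (a : UnitAddCircle) : ℂ) = circleMap 0 1 (2 * Real.pi * a) := by
    intro a
    rw [fourier_coe_apply]
    simp [circleMap]
    ring_nf
  simp only [h1]
  have h2 := intervalIntegral.integral_comp_mul_left (a := 0) (b := 1)
    (fun θ => Real.log ‖p.eval (circleMap 0 1 θ)‖) (c := 2 * Real.pi) (by positivity)
  simpa using h2

lemma lm_one_nonneg {ι : Type} [Fintype ι] [Nonempty ι] (f : ι → Unit → ℤ) (c : ι → ℂ)
    (hc : ∀ j, 1 ≤ ‖c j‖) (hf : Function.Injective f) : 0 ≤ lm Finset.univ c f := by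
  classical
  obtain ⟨N, hN⟩ : ∃ N : ℤ, ∀ j, 0 ≤ f j () + N := by
    refine ⟨∑ j, |f j ()|, fun j => ?_⟩
    have h1 := Finset.single_le_sum (f := fun j => |f j ()|) (fun i _ => abs_nonneg _)
      (Finset.mem_univ j)
    have h2 := neg_abs_le (f j ())
    linarith
  set m : ι → ℕ := fun j => (f j () + N).toNat with hm
  have hmN : ∀ j, (m j : ℤ) = f j () + N := fun j => Int.toNat_of_nonneg (hN j)
  have hminj : Function.Injective m := by
    intro i j hij
    apply hf
    funext a
    have h1 := hmN i
    have h2 := hmN j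
    rw [hij] at h1
    change f i () = f j ()
    linarith
  set p : Polynomial ℂ := ∑ j, Polynomial.monomial (m j) (c j) with hp
  have hcoeff : ∀ n, p.coeff n = ∑ j, if m j = n then c j else 0 := by
    intro n
    rw [hp, Polynomial.finsetSum_coeff]
    simp [Polynomial.coeff_monomial]
  have hcj : ∀ j, p.coeff (m j) = c j := by
    intro j
    rw [hcoeff, Finset.sum_eq_single j]
    · simp
    · intro i _ hij
      rw [if_neg (fun h => hij (hminj h))]
    · simp
  have hp0 : p ≠ 0 := by
    intro h0
    obtain ⟨j⟩ := ‹Nonempty ι›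
    have h1 := hcj j
    rw [h0, Polynomial.coeff_zero] at h1
    have h2 := hc j
    rw [← h1] at h2
    norm_num at h2
  have hlead : 1 ≤ ‖p.leadingCoeff‖ := by
    have h1 : p.coeff p.natDegree ≠ 0 := Polynomial.leadingCoeff_ne_zero.mpr hp0
    obtain ⟨j, hj⟩ : ∃ j, m j = p.natDegree := by
      by_contra hcon
      push Not at hcon
      apply h1
      rw [hcoeff]
      apply Finset.sum_eq_zero
      intro j _
      rw [if_neg (hcon j)]
    rw [Polynomial.leadingCoeff, ← hj, hcj]
    exact hc j
  have hval : ∀ x : UnitAddTorus Unit,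
      ‖pol Finset.univ c f x‖ = ‖p.eval (fourier 1 (x ()))‖ := by
    intro x
    have h1 : p.eval (fourier 1 (x ())) = fourier N (x ()) * pol Finset.univ c f x := by
      rw [hp, Polynomial.eval_finsetSum, pol, Finset.mul_sum]
      apply Finset.sum_congr rfl
      intro j _
      rw [Polynomial.eval_monomial]
      have h2 : (fourier 1 (x ()) : ℂ) ^ m j = fourier (m j : ℤ) (x ()) := by
        simp [fourier_apply, AddCircle.toCircle_nsmul]
      have h3 : mFourier (f j) x = fourier (f j ()) (x ()) := by
        simp [mFourier]
      rw [h2, h3, hmN, fourier_add]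
      ring
    rw [h1, norm_mul]
    rw [fourier_apply, Circle.norm_coe, one_mul]
  have hmp := volume_preserving_funUnique Unit UnitAddCircle
  have hfin : lm Finset.univ c f = p.logMahlerMeasure := by
    rw [← circle_int_eq, lm]
    simp only [hval]
    exact hmp.integral_comp (MeasurableEquiv.measurableEmbedding _)
      (fun y : UnitAddCircle => Real.log ‖p.eval (fourier 1 y)‖)
  rw [hfin, Polynomial.logMahlerMeasure_eq_log_MahlerMeasure]
  exact Real.log_nonneg (Polynomial.one_le_mahlerMeasure_of_one_le_norm_leadingCoeff hlead)

lemma exists_sep {ι : Type} [Fintype ι] {k : ℕ} (e : ι → Fin k → ℤ) (he : Function.Injective e) :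
    ∃ N : ℤ, Function.Injective fun j => ∑ a : Fin k, N ^ (a : ℕ) * e j a := by
  classical
  set P : ι → Polynomial ℤ := fun j => ∑ a : Fin k, Polynomial.monomial (a : ℕ) (e j a) with hP
  have hPinj : ∀ i j, i ≠ j → P i - P j ≠ 0 := by
    intro i j hij h0
    apply hij
    apply he
    have h1 : ∀ j (b : Fin k), (P j).coeff (b : ℕ) = e j b := by
      intro j b
      rw [hP]
      simp only [Polynomial.finsetSum_coeff, Polynomial.coeff_monomial, Fin.val_inj]
      simp
    funext b
    rw [← h1, ← h1, sub_eq_zero.mp h0]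
  set Q : Polynomial ℤ := ∏ i, ∏ j, if i = j then 1 else P i - P j with hQ
  have hQ0 : Q ≠ 0 := by
    rw [hQ]
    refine Finset.prod_ne_zero_iff.mpr fun i _ => Finset.prod_ne_zero_iff.mpr fun j _ => ?_
    split_ifs with h
    · exact one_ne_zero
    · exact hPinj i j h
  obtain ⟨N, hN⟩ : ∃ N, Q.eval N ≠ 0 := by
    by_contra hcon
    push Not at hcon
    exact hQ0 (Polynomial.funext (by simpa using hcon))
  refine ⟨N, fun i j hij => ?_⟩
  by_contra hne
  apply hN
  rw [hQ, Polynomial.eval_prod]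
  apply Finset.prod_eq_zero (Finset.mem_univ i)
  rw [Polynomial.eval_prod]
  apply Finset.prod_eq_zero (Finset.mem_univ j)
  rw [if_neg hne, Polynomial.eval_sub, sub_eq_zero]
  simp only [hP, Polynomial.eval_finsetSum, Polynomial.eval_monomial]
  simpa only [mul_comm] using hij

lemma lm_nonneg {ι : Type} [Fintype ι] [Nonempty ι] {k : ℕ} (e : ι → Fin k → ℤ) (c : ι → ℂ)
    (hc : ∀ j, 1 ≤ ‖c j‖) (he : Function.Injective e) : 0 ≤ lm Finset.univ c e := by
  obtain ⟨N, hN⟩ := exists_sep e he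
  rw [lm_prod (Fin k) Unit e (fun j _ => ∑ a : Fin k, N ^ (a : ℕ) * e j a) _ c hc he]
  · apply integral_nonneg
    intro z
    apply lm_one_nonneg
    · intro j; rw [tw_norm]; exact hc j
    · intro i j hij
      exact hN (congrFun hij ())
  · intro v hv
    funext _
    simp only [Finset.sum_apply, Pi.smul_apply, smul_eq_mul, Finset.mul_sum, Pi.zero_apply]
    rw [Finset.sum_comm]
    apply Finset.sum_eq_zero
    intro a _
    have := congrFun hv a
    simp only [Finset.sum_apply, Pi.smul_apply, smul_eq_mul, Pi.zero_apply] at this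
    calc ∑ j, v j * (N ^ (a : ℕ) * e j a) = N ^ (a : ℕ) * ∑ j, v j * e j a := by
          rw [Finset.mul_sum]
          exact Finset.sum_congr rfl fun j _ => by ring
      _ = 0 := by rw [this, mul_zero]

lemma lm_tw_cont {ι : Type} [Fintype ι] [Nonempty ι] (d d' : Type) [Fintype d] [Fintype d']
    (e : ι → d → ℤ) (f : ι → d' → ℤ) (c : ι → ℂ) (hc : ∀ j, 1 ≤ ‖c j‖)
    (hf : Function.Injective f) : Continuous fun z => lm Finset.univ (tw c e z) f := by
  obtain ⟨n, hn⟩ : ∃ n, (Finset.univ : Finset ι).card = n + 1 :=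
    Nat.exists_eq_succ_of_ne_zero (Finset.card_pos.mpr Finset.univ_nonempty).ne'
  apply continuous_of_uniform_approx_of_continuous
  intro u hu
  obtain ⟨η, hη, hηu⟩ := Metric.mem_uniformity_dist.mp hu
  obtain ⟨ε, hε, H⟩ := unif n (η / 2) (by positivity)
  refine ⟨fun z => ∫ w, tlog Finset.univ (tw c e z) f ε w, ?_, ?_⟩
  · have hcont : Continuous (Function.uncurry fun (z : UnitAddTorus d) (w : UnitAddTorus d') =>
        tlog Finset.univ (tw c e z) f ε w) := by
      unfold tlog pol tw Function.uncurry
      refine Continuous.log ?_ ?_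
      · fun_prop
      · intro x
        exact (lt_max_of_lt_right hε).ne'
    have := continuous_parametric_integral_of_continuous
      (μ := (volume : Measure (UnitAddTorus d'))) hcont isCompact_univ
    simpa using this
  · intro z
    apply hηu
    have := (H _ _ Finset.univ (tw c e z) f hn hf.injOn (fun j _ => by
      rw [tw_norm]; exact hc j)).2
    rw [Real.dist_eq]
    linarith

lemma lm_zero_of_zero {ι : Type} [Fintype ι] [Nonempty ι] (d : Type) [Fintype d] {k : ℕ}
    (e : ι → d → ℤ) (f : ι → Fin k → ℤ)
    (h : ∀ v : ι → ℤ, ∑ j, v j • e j = 0 → ∑ j, v j • f j = 0)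
    (c : ι → ℂ) (hc : ∀ j, 1 ≤ ‖c j‖) (he : Function.Injective e) (hf : Function.Injective f)
    (h0 : lm Finset.univ c e = 0) : lm Finset.univ c f = 0 := by
  rw [lm_prod d (Fin k) e f h c hc he] at h0
  have hcont := lm_tw_cont d (Fin k) e f c hc hf
  have hnn : 0 ≤ fun z => lm Finset.univ (tw c e z) f := by
    intro z
    apply lm_nonneg
    · intro j; rw [tw_norm]; exact hc j
    · exact hf
  rw [integral_eq_zero_iff_of_nonneg hnn
    (hcont.integrable_of_hasCompactSupport (HasCompactSupport.of_compactSpace _))] at h0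
  have h1 := (Continuous.ae_eq_iff_eq _ hcont continuous_zero).mp h0
  have h2 := congrFun h1 0
  have h3 : tw c e 0 = c := by
    funext j
    simp [tw, mF_zero_right]
  simpa [h3] using h2

lemma evalT_torusPt {k : ℕ} (F : LPoly k) (t : Fin k → ℝ) :
    evalT F (torusPt t) = pol F.support F id (fun i => ((t i : ℝ) : UnitAddCircle)) := by
  unfold evalT pol
  refine Finset.sum_congr rfl fun e _ => ?_
  congr 1
  change _ = ∏ i, fourier (e i) ((t i : ℝ) : UnitAddCircle)
  refine Finset.prod_congr rfl fun i _ => ?_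
  rw [fourier_coe_apply, torusPt, ← Complex.exp_int_mul]
  congr 1
  push_cast
  ring

lemma mm_eq_lm {k : ℕ} (F : LPoly k) : mm F = lm F.support F id := by
  have hmp := measurePreserving_pi (fun _ : Fin k => volume.restrict (Set.Ioc (0:ℝ) (0 + 1)))
    (fun _ : Fin k => (volume : Measure UnitAddCircle))
    (fun _ => UnitAddCircle.measurePreserving_mk 0)
  have hm : AEStronglyMeasurable (fun x : UnitAddTorus (Fin k) => Real.log ‖pol F.support F id x‖)
      (Measure.pi fun _ : Fin k => (volume : Measure UnitAddCircle)) := by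
    apply Measurable.aestronglyMeasurable
    exact Real.measurable_log.comp (pol_cont _ _ _).norm.measurable
  unfold mm lm
  simp only [evalT_torusPt]
  have hset : (volume : Measure (Fin k → ℝ)).restrict (Set.Icc 0 1) =
      Measure.pi (fun _ : Fin k => volume.restrict (Set.Ioc (0:ℝ) (0 + 1))) := by
    rw [← Measure.restrict_pi_pi]
    refine (Measure.restrict_congr_set ?_).symm
    have := Measure.univ_pi_Ioc_ae_eq_Icc (μ := fun _ : Fin k => (volume : Measure ℝ))
      (f := fun _ => (0:ℝ)) (g := fun _ => (0:ℝ) + 1)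
    simpa [Pi.zero_def, Pi.one_def, volume_pi] using this
  rw [hset]
  change _ = ∫ x, _ ∂(Measure.pi fun _ : Fin k => (volume : Measure UnitAddCircle))
  rw [← hmp.map_eq] at hm ⊢
  rw [integral_map hmp.measurable.aemeasurable hm]

lemma MB_char (B x : ℝ) : x ∈ MBset B ↔ ∃ (k t : ℕ) (c : Fin (t+1) → ℤ)
    (e : Fin (t+1) → Fin k → ℤ), Function.Injective e ∧ (∀ j, c j ≠ 0) ∧
    (∑ j, |(c j : ℝ)|) ≤ B ∧ lm Finset.univ (fun j => (c j : ℂ)) e = x := by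
  classical
  constructor
  · rintro ⟨k, F, hF, hint, hlen, rfl⟩
    choose n hn using hint
    obtain ⟨t, ht⟩ : ∃ t, F.support.card = t + 1 :=
      Nat.exists_eq_succ_of_ne_zero (by simpa using hF)
    let σ : Fin (t+1) ≃ F.support := (F.support.equivFinOfCardEq ht).symm
    refine ⟨k, t, fun j => n (σ j), fun j => (σ j).1,
      Subtype.val_injective.comp σ.injective, ?_, ?_, ?_⟩
    · intro j h
      have h1 := (Finsupp.mem_support_iff.mp (σ j).2)
      have h2 : n (σ j) = 0 := h
      rw [hn, h2] at h1
      simp at h1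
    · refine le_trans (le_of_eq ?_) hlen
      rw [← Finset.sum_coe_sort F.support, ← σ.sum_comp]
      refine Finset.sum_congr rfl fun j _ => ?_
      rw [hn]
      simp
    · rw [mm_eq_lm]
      unfold lm
      congr 1
      funext x
      congr 2
      unfold pol
      rw [← Finset.sum_coe_sort F.support, ← σ.sum_comp]
      refine Finset.sum_congr rfl fun j _ => ?_
      simp only [← hn, id]
  · rintro ⟨k, t, c, e, he, hc, hlen, rfl⟩
    let F : LPoly k := Finsupp.embDomain ⟨e, he⟩
      (Finsupp.equivFunOnFinite.symm (fun j => (c j : ℂ)))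
    have hs0 : (Finsupp.equivFunOnFinite.symm (fun j => (c j : ℂ)) : Fin (t+1) →₀ ℂ).support
        = Finset.univ := by
      ext j
      simp [hc j]
    have hs : F.support = Finset.univ.map ⟨e, he⟩ := by
      rw [Finsupp.support_embDomain, hs0]
    have hv : ∀ j, F (e j) = c j := by
      intro j
      exact Finsupp.embDomain_apply_self ⟨e, he⟩ _ j
    refine ⟨k, F, ?_, ?_, ?_, ?_⟩
    · intro h
      have := hv 0
      rw [h] at this
      simp only [Finsupp.coe_zero, Pi.zero_apply] at this
      exact hc 0 (by exact_mod_cast this.symm)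
    · intro v
      by_cases hvs : v ∈ F.support
      · rw [hs, Finset.mem_map] at hvs
        obtain ⟨j, _, rfl⟩ := hvs
        exact ⟨c j, hv j⟩
      · exact ⟨0, by simpa using hvs⟩
    · rw [hs, Finset.sum_map]
      refine le_trans (le_of_eq ?_) hlen
      refine Finset.sum_congr rfl fun j _ => ?_
      change ‖F (e j)‖ = _
      rw [hv]
      simp
    · rw [mm_eq_lm]
      unfold lm
      congr 1
      funext x
      congr 2
      unfold pol
      rw [hs, Finset.sum_map]
      refine Finset.sum_congr rfl fun j _ => ?_
      change F (e j) * _ = _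
      rw [hv]
      rfl

lemma limit_lattice {ι Y : Type} [Fintype ι] (u : Ultrafilter Y) (k : Y → ℕ)
    (e : ∀ y, ι → Fin (k y) → ℤ) (he : ∀ᶠ y in (u : Filter Y), Function.Injective (e y)) :
    ∃ (l : ℕ) (e' : ι → Fin l → ℤ), Function.Injective e' ∧
      (∀ v : ι → ℤ, ∀ᶠ y in (u : Filter Y), (∑ j, v j • e y j = 0 ↔ ∑ j, v j • e' j = 0)) ∧
      (∀ᶠ y in (u : Filter Y), ∀ v : ι → ℤ, ∑ j, v j • e' j = 0 → ∑ j, v j • e y j = 0) := by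
  classical
  let Λ : Submodule ℤ (ι → ℤ) :=
    { carrier := {v | ∀ᶠ y in (u : Filter Y), ∑ j, v j • e y j = 0}
      zero_mem' := by simp
      add_mem' := by
        intro a b ha hb
        simp only [Set.mem_ofPred_eq] at ha hb ⊢
        filter_upwards [ha, hb] with y h1 h2
        simp only [Pi.add_apply, add_smul, Finset.sum_add_distrib, h1, h2, add_zero]
      smul_mem' := by
        intro n a ha
        simp only [Set.mem_ofPred_eq] at ha ⊢
        filter_upwards [ha] with y h1
        have : ∑ j, (n • a) j • e y j = n • ∑ j, a j • e y j := by
          rw [Finset.smul_sum]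
          refine Finset.sum_congr rfl fun j _ => ?_
          rw [Pi.smul_apply, smul_assoc]
        rw [this, h1, smul_zero] }
  have hΛ : ∀ v, v ∈ Λ ↔ ∀ᶠ y in (u : Filter Y), ∑ j, v j • e y j = 0 := fun v => Iff.rfl
  have htf : Module.IsTorsionFree ℤ ((ι → ℤ) ⧸ Λ) := by
    constructor
    intro r hr
    have hr0 : r ≠ 0 := hr.ne_zero
    rw [isSMulRegular_iff_right_eq_zero_of_smul]
    intro q hq
    obtain ⟨v, rfl⟩ := Submodule.Quotient.mk_surjective _ q
    rw [← Submodule.Quotient.mk_smul, Submodule.Quotient.mk_eq_zero, hΛ] at hq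
    rw [Submodule.Quotient.mk_eq_zero, hΛ]
    filter_upwards [hq] with y h1
    have : ∑ j, (r • v) j • e y j = r • ∑ j, v j • e y j := by
      rw [Finset.smul_sum]
      refine Finset.sum_congr rfl fun j _ => ?_
      rw [Pi.smul_apply, smul_assoc]
    rw [this] at h1
    exact (smul_eq_zero.mp h1).resolve_left hr0
  let φ : ((ι → ℤ) ⧸ Λ) ≃ₗ[ℤ] (Fin (Module.finrank ℤ ((ι → ℤ) ⧸ Λ)) → ℤ) :=
    (Module.finBasis ℤ ((ι → ℤ) ⧸ Λ)).equivFun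
  let e' : ι → Fin (Module.finrank ℤ ((ι → ℤ) ⧸ Λ)) → ℤ :=
    fun j => φ (Submodule.Quotient.mk (Pi.single j 1))
  have hsum : ∀ v : ι → ℤ, ∑ j, v j • e' j = φ (Λ.mkQ v) := by
    intro v
    have hv : v = ∑ j, v j • (Pi.single j 1 : ι → ℤ) := by
      ext i
      simp [Finset.sum_apply, Pi.single_apply]
    conv_rhs => rw [hv]
    rw [map_sum, map_sum]
    refine Finset.sum_congr rfl fun j _ => ?_
    rw [map_smul, map_smul]
    rfl
  have hrel : ∀ v : ι → ℤ, ∑ j, v j • e' j = 0 ↔ v ∈ Λ := by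
    intro v
    rw [hsum, LinearEquiv.map_eq_zero_iff, Submodule.mkQ_apply, Submodule.Quotient.mk_eq_zero]
  refine ⟨_, e', ?_, ?_, ?_⟩
  · intro a b hab
    by_contra hne
    have h1 : (Pi.single a 1 - Pi.single b 1 : ι → ℤ) ∈ Λ := by
      rw [← hrel]
      simp [Pi.single_apply, sub_smul, Finset.sum_sub_distrib, hab]
    rw [hΛ] at h1
    obtain ⟨y, h2, h3⟩ := (h1.and he).exists
    simp only [Pi.sub_apply, Pi.single_apply, sub_smul, Finset.sum_sub_distrib, ite_smul, one_smul,
      zero_smul, Finset.sum_ite_eq', Finset.mem_univ, if_true] at h2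
    exact hne (h3 (sub_eq_zero.mp h2))
  · intro v
    by_cases hv : v ∈ Λ
    · filter_upwards [(hΛ v).mp hv] with y hy
      exact iff_of_true hy ((hrel v).mpr hv)
    · have hv2 : ∀ᶠ y in (u : Filter Y), ¬ (∑ j, v j • e y j = 0) :=
        Ultrafilter.eventually_not.mpr (fun h => hv ((hΛ v).mpr h))
      filter_upwards [hv2] with y hy
      simp only [hy, hrel, hv]
  · obtain ⟨s, hs⟩ := (IsNoetherian.noetherian Λ : Λ.FG)
    have h1 : ∀ᶠ y in (u : Filter Y), ∀ v ∈ s, ∑ j, v j • e y j = 0 := by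
      rw [Filter.eventually_all_finset]
      intro v hv
      rw [← hΛ, ← hs]
      exact Submodule.subset_span hv
    filter_upwards [h1] with y hy v hv
    rw [hrel, ← hs] at hv
    induction hv using Submodule.span_induction with
    | mem x hx => exact hy x hx
    | zero => simp
    | add a b _ _ ha hb => simp only [Pi.add_apply, add_smul, Finset.sum_add_distrib, ha, hb, add_zero]
    | smul n a _ ha =>
      have : ∑ j, (n • a) j • e y j = n • ∑ j, a j • e y j := by
        rw [Finset.smul_sum]
        refine Finset.sum_congr rfl fun j _ => ?_
        rw [Pi.smul_apply, smul_assoc]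
      rw [this, ha, smul_zero]

lemma key (B x : ℝ) (S : Set ℝ) (hS : S ⊆ MBset B) (hx : x ∈ closure S) :
    ∃ (t : ℕ) (c : Fin (t+1) → ℤ) (l : ℕ) (e' : Fin (t+1) → Fin l → ℤ),
      Function.Injective e' ∧ (∀ j, c j ≠ 0) ∧ (∑ j, |(c j : ℝ)|) ≤ B ∧
      lm Finset.univ (fun j => (c j : ℂ)) e' = x ∧
      ∃ y ∈ S, ∃ (k : ℕ) (f : Fin (t+1) → Fin k → ℤ), Function.Injective f ∧
        lm Finset.univ (fun j => (c j : ℂ)) f = y ∧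
        ∀ v : Fin (t+1) → ℤ, ∑ j, v j • e' j = 0 → ∑ j, v j • f j = 0 := by
  classical
  obtain ⟨u, hu, hux⟩ := mem_closure_iff_ultrafilter.mp hx
  let P : (Σ t : ℕ, Fin (t+1) → ℤ) → ℝ → Prop := fun p y =>
    y ∈ S ∧ (∀ j, p.2 j ≠ 0) ∧ (∑ j, |(p.2 j : ℝ)|) ≤ B ∧
    ∃ (k : ℕ) (e : Fin (p.1+1) → Fin k → ℤ), Function.Injective e ∧
      lm Finset.univ (fun j => (p.2 j : ℂ)) e = y
  let T : Finset (Σ t : ℕ, Fin (t+1) → ℤ) := (Finset.range (⌊B⌋₊ + 1)).sigma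
    (fun t => Fintype.piFinset fun _ => Finset.Icc (-(⌊B⌋₊ : ℤ)) ⌊B⌋₊)
  have h1 : ∀ᶠ y in (u : Filter ℝ), ∃ p ∈ (T : Set (Σ t : ℕ, Fin (t+1) → ℤ)), P p y := by
    filter_upwards [hu] with y hy
    obtain ⟨k, t, c, e, he, hc, hlen, hlm⟩ := (MB_char B y).mp (hS hy)
    refine ⟨⟨t, c⟩, ?_, hy, hc, hlen, k, e, he, hlm⟩
    have hone : ∀ j, (1:ℝ) ≤ |(c j : ℝ)| := by
      intro j
      have := Int.one_le_abs (hc j)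
      exact_mod_cast this
    have hcard : ((t + 1 : ℕ) : ℝ) ≤ B := by
      refine le_trans ?_ hlen
      have := Finset.sum_le_sum (s := Finset.univ) (fun j _ => hone j)
      simpa using this
    have hle : ∀ j, |(c j : ℝ)| ≤ B := fun j =>
      le_trans (Finset.single_le_sum (f := fun j => |(c j : ℝ)|)
        (fun i _ => abs_nonneg _) (Finset.mem_univ j)) hlen
    simp only [T, Finset.mem_coe, Finset.mem_sigma, Finset.mem_range, Fintype.mem_piFinset,
      Finset.mem_Icc]
    refine ⟨?_, fun j => ?_⟩
    · have := Nat.le_floor hcard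
      omega
    · have h2 : ((c j).natAbs : ℝ) ≤ B := by
        rw [Nat.cast_natAbs]
        exact_mod_cast hle j
      have := Nat.le_floor h2
      omega
  obtain ⟨⟨t, c⟩, _, hP⟩ := (Ultrafilter.eventually_exists_mem_iff T.finite_toSet).mp h1
  have hQ : ∀ y : ℝ, ∃ (k : ℕ) (e : Fin (t+1) → Fin k → ℤ), P ⟨t, c⟩ y →
      Function.Injective e ∧ lm Finset.univ (fun j => (c j : ℂ)) e = y := by
    intro y
    by_cases hy : P ⟨t, c⟩ y
    · obtain ⟨_, _, _, k, e, h⟩ := hy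
      exact ⟨k, e, fun _ => h⟩
    · exact ⟨0, 0, fun h => absurd h hy⟩
  choose k e hke using hQ
  have hinj : ∀ᶠ y in (u : Filter ℝ), Function.Injective (e y) := by
    filter_upwards [hP] with y hy using (hke y hy).1
  obtain ⟨l, e', he', hrel, hsub⟩ := limit_lattice u k e hinj
  obtain ⟨y, hy, hys⟩ := (hP.and hsub).exists
  have hc : ∀ j, c j ≠ 0 := hy.2.1
  have hlen : (∑ j, |(c j : ℝ)|) ≤ B := hy.2.2.1
  have hc1 : ∀ j, 1 ≤ ‖(c j : ℂ)‖ := by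
    intro j
    have := Int.one_le_abs (hc j)
    rw [Complex.norm_intCast]
    exact_mod_cast this
  refine ⟨t, c, l, e', he', hc, hlen, ?_, y, hy.1, k y, e y, (hke y hy).1, (hke y hy).2, hys⟩
  have hlim := lm_tendsto (u : Filter ℝ) (fun y => Fin (k y)) e (Fin l) e' hrel
    (fun j => (c j : ℂ)) hc1 hinj he'
  have hlim2 : Tendsto (fun y => lm Finset.univ (fun j => (c j : ℂ)) (e y)) (u : Filter ℝ) (𝓝 x) := by
    have h3 : Tendsto id (u : Filter ℝ) (𝓝 x) := hux
    refine h3.congr' ?_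
    filter_upwards [hP] with y hy using (hke y hy).2.symm
  exact tendsto_nhds_unique hlim hlim2

/-- **Theorem 3.** For any `B > 0`, the set `ℳ_B` of Mahler measures of integer
Laurent polynomials of length at most `B` is closed, and `0` is an isolated point
of it. -/
theorem MBset_isClosed_and_zero_isolated (B : ℝ) (hB : 0 < B) :
    IsClosed (MBset B) ∧ ∃ ε > 0, MBset B ∩ Set.Ioo 0 ε = ∅ := by
  constructor
  · refine isClosed_of_closure_subset fun x hx => ?_
    obtain ⟨t, c, l, e', he', hc, hlen, hlm, _⟩ := key B x (MBset B) subset_rfl hx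
    exact (MB_char B x).mpr ⟨l, t, c, e', he', hc, hlen, hlm⟩
  · by_contra hcon
    push Not at hcon
    have h0 : (0:ℝ) ∈ closure (MBset B ∩ Set.Ioi 0) := by
      rw [Metric.mem_closure_iff]
      intro ε hε
      obtain ⟨y, hy, hy2⟩ := hcon ε hε
      refine ⟨y, ⟨hy, hy2.1⟩, ?_⟩
      rw [dist_comm, Real.dist_eq, sub_zero, abs_of_pos hy2.1]
      exact hy2.2
    obtain ⟨t, c, l, e', he', hc, hlen, hlm, y, hy, k, f, hf, hfy, hrel⟩ :=
      key B 0 _ Set.inter_subset_left h0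
    have hc1 : ∀ j, 1 ≤ ‖(c j : ℂ)‖ := by
      intro j
      have := Int.one_le_abs (hc j)
      rw [Complex.norm_intCast]
      exact_mod_cast this
    have := lm_zero_of_zero (Fin l) e' f hrel _ hc1 he' hf hlm
    rw [hfy] at this
    exact absurd this (ne_of_gt hy.2)
end
end
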